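/- There exist absolute constants C, c > 0 such that the following holds. Let X = (ℝⁿ, ‖·‖) be a normed space whose unit ball B_X is in John's position and let 0 < δ < 1/2. Then at least one of the following holds: either the critical dimension satisfies k(X) ≥ n^{1/2 − δ}; or there exists a linear subspace F ⊆ ℝⁿ with dim F = m ≥ c·n^{1/2} and an invertible linear map T : F → F such that for all t > 0, P( | ‖TZ‖ − E‖TZ‖ | > t · E‖TZ‖ ) ≤ C exp( −c·δ · max{t², t} · log m ), where Z is a standard Gaussian vector on F (Z ~ N(0, I_F)). -/

import Mathlib

open MeasureTheory ProbabilityTheory Real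

/-- The standard Gaussian measure `γ_d` on `ℝᵈ`. -/
noncomputable def stdGaussian (d : ℕ) : Measure (Fin d → ℝ) :=
  Measure.pi fun _ => gaussianReal 0 1

/-- The Euclidean norm on `ℝᵈ`. -/
noncomputable def euclNorm {d : ℕ} (x : Fin d → ℝ) : ℝ :=
  Real.sqrt (∑ i, (x i) ^ 2)

/-- `b(X) = max{ N θ : ‖θ‖₂ = 1 }`, the Lipschitz constant of the norm `N`. -/
noncomputable def bConst {d : ℕ} (N : (Fin d → ℝ) → ℝ) : ℝ :=
  sSup {s | ∃ θ : Fin d → ℝ, euclNorm θ = 1 ∧ s = N θ}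

/-- The critical dimension (Dvoretzky number) `k(X) = (E N(G) / b(X))²`. -/
noncomputable def critDim (d : ℕ) (N : (Fin d → ℝ) → ℝ) : ℝ :=
  ((∫ x, N x ∂stdGaussian d) / bConst N) ^ 2

/-- The unit ball of `N` is in John's position: the Euclidean unit ball is contained in
it, and any affine image of the Euclidean unit ball contained in it has volume at most
that of the Euclidean unit ball. -/
def JohnPosition {d : ℕ} (N : (Fin d → ℝ) → ℝ) : Prop :=
  (∀ x, euclNorm x ≤ 1 → N x ≤ 1) ∧
  ∀ (T : (Fin d → ℝ) →ₗ[ℝ] (Fin d → ℝ)) (v : Fin d → ℝ),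
    (∀ x, euclNorm x ≤ 1 → N (T x + v) ≤ 1) →
    MeasureTheory.volume ((fun x => T x + v) '' {x | euclNorm x ≤ 1})
      ≤ MeasureTheory.volume {x : Fin d → ℝ | euclNorm x ≤ 1}

open scoped BigOperators Topology

/-- The sign vector `ε` with its coordinate `a` flipped. -/
def flipAt {V : Type*} [DecidableEq V] (a : V) (ε : V → Bool) : V → Bool :=
  Function.update ε a (!ε a)

lemma flipAt_flipAt {V : Type*} [DecidableEq V] (a : V) (ε : V → Bool) :
    flipAt a (flipAt a ε) = ε := by
  simp [flipAt]

/-- Flipping a coordinate, as an involution of the cube. -/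
def flipEquiv {V : Type*} [DecidableEq V] (a : V) : (V → Bool) ≃ (V → Bool) :=
  ⟨flipAt a, flipAt a, flipAt_flipAt a, flipAt_flipAt a⟩

lemma expect_flipAt {V : Type*} [Fintype V] [DecidableEq V] (a : V) (g : (V → Bool) → ℝ) :
    𝔼 ε, g (flipAt a ε) = 𝔼 ε, g ε :=
  Fintype.expect_equiv (flipEquiv a) _ _ fun _ => rfl

lemma expect_cons {k : ℕ} (g : (Fin (k + 1) → Bool) → ℝ) :
    𝔼 ε, g ε = (𝔼 ε : Fin k → Bool, g (Fin.cons true ε)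
      + 𝔼 ε : Fin k → Bool, g (Fin.cons false ε)) / 2 := by
  simp only [Fintype.expect_eq_sum_div_card]
  rw [← (Fin.consEquiv fun _ => Bool).sum_comp, Fintype.sum_prod_type]
  simp [Fin.consEquiv, pow_succ]
  ring

lemma flipAt_zero_cons {k : ℕ} (b : Bool) (ε : Fin k → Bool) :
    flipAt 0 (Fin.cons b ε : Fin (k + 1) → Bool) = Fin.cons (!b) ε := by
  simp [flipAt, Fin.update_cons_zero]

lemma flipAt_succ_cons {k : ℕ} (b : Bool) (a : Fin k) (ε : Fin k → Bool) :
    flipAt a.succ (Fin.cons b ε : Fin (k + 1) → Bool) = Fin.cons b (flipAt a ε) := by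
  simp [flipAt, Fin.cons_update]

/-- Entropy with respect to the uniform measure on the cube. -/
noncomputable def cubeEnt {V : Type*} [Fintype V] [DecidableEq V] (g : (V → Bool) → ℝ) : ℝ :=
  𝔼 ε, g ε * log (g ε) - (𝔼 ε, g ε) * log (𝔼 ε, g ε)

lemma expect_mono {ι : Type*} [Fintype ι] {f g : ι → ℝ} (h : ∀ i, f i ≤ g i) :
    𝔼 i, f i ≤ 𝔼 i, g i :=
  Finset.expect_le_expect fun i _ => h i

lemma expect_nonneg' {ι : Type*} [Fintype ι] {f : ι → ℝ} (h : ∀ i, 0 ≤ f i) :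
    0 ≤ 𝔼 i, f i :=
  Finset.expect_nonneg fun i _ => h i

/-- Cauchy-Schwarz. -/
lemma expect_mul_sq_le {ι : Type*} [Fintype ι] (f g : ι → ℝ) :
    (𝔼 i, f i * g i) ^ 2 ≤ (𝔼 i, f i ^ 2) * 𝔼 i, g i ^ 2 := by
  simp only [Fintype.expect_eq_sum_div_card, div_pow, div_mul_div_comm]
  rw [← sq]
  gcongr
  exact Finset.sum_mul_sq_le_sq_mul_sq _ _ _

lemma two_point_entropy {G H : ℝ} (hG : 0 ≤ G) (hH : 0 ≤ H) :
    (G ^ 2 * log (G ^ 2) + H ^ 2 * log (H ^ 2)) / 2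
      - (G ^ 2 + H ^ 2) / 2 * log ((G ^ 2 + H ^ 2) / 2) ≤ (G - H) ^ 2 := by
  rcases eq_or_lt_of_le (show 0 ≤ (G ^ 2 + H ^ 2) / 2 by positivity) with h0 | hpos
  · have h1 : G = 0 := by nlinarith [sq_nonneg G, sq_nonneg H]
    have h2 : H = 0 := by nlinarith [sq_nonneg G, sq_nonneg H]
    simp [h1, h2]
  set μ := (G ^ 2 + H ^ 2) / 2 with hμ
  have key : ∀ x : ℝ, 0 ≤ x → x * log x - x * log μ ≤ x * (x / μ - 1) := by
    intro x hx
    rcases eq_or_lt_of_le hx with rfl | hx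
    · simp
    rw [← mul_sub, ← log_div hx.ne' hpos.ne']
    gcongr
    exact log_le_sub_one_of_pos (by positivity)
  have h1 := key _ (sq_nonneg G)
  have h2 := key _ (sq_nonneg H)
  have h3 : G ^ 2 * (G ^ 2 / μ - 1) + H ^ 2 * (H ^ 2 / μ - 1) ≤ 2 * (G - H) ^ 2 := by
    have : G ^ 2 * (G ^ 2 / μ - 1) + H ^ 2 * (H ^ 2 / μ - 1)
        = (G ^ 4 + H ^ 4 - (G ^ 2 + H ^ 2) * μ) / μ := by field_simp; ring
    rw [this, div_le_iff₀ hpos, hμ]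
    nlinarith [mul_nonneg (sq_nonneg (G - H)) (sq_nonneg (G - H))]
  have h4 : (G ^ 2 + H ^ 2) / 2 * log μ = G ^ 2 * log μ / 2 + H ^ 2 * log μ / 2 := by ring
  rw [← hμ] at h4
  linarith

lemma sq_sub_sqrt_le {ι : Type*} [Fintype ι] (f g : ι → ℝ) :
    (√(𝔼 i, f i ^ 2) - √(𝔼 i, g i ^ 2)) ^ 2 ≤ 𝔼 i, (f i - g i) ^ 2 := by
  have hf : 0 ≤ 𝔼 i, f i ^ 2 := expect_nonneg' fun i => sq_nonneg _
  have hg : 0 ≤ 𝔼 i, g i ^ 2 := expect_nonneg' fun i => sq_nonneg _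
  have hcs : 𝔼 i, f i * g i ≤ √(𝔼 i, f i ^ 2) * √(𝔼 i, g i ^ 2) := by
    rw [← sqrt_mul hf]
    exact le_sqrt_of_sq_le (expect_mul_sq_le f g)
  have hexp : 𝔼 i, (f i - g i) ^ 2
      = 𝔼 i, f i ^ 2 - 2 * (𝔼 i, f i * g i) + 𝔼 i, g i ^ 2 := by
    rw [Finset.mul_expect, ← Finset.expect_sub_distrib, ← Finset.expect_add_distrib]
    exact Finset.expect_congr rfl fun i _ => by ring
  rw [hexp, sub_sq, sq_sqrt hf, sq_sqrt hg]
  linarith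

/-- The logarithmic Sobolev inequality on the cube `{±1}ᵏ`. -/
lemma cubeEnt_sq_le_fin (k : ℕ) (g : (Fin k → Bool) → ℝ) :
    cubeEnt (fun ε => g ε ^ 2) ≤ ∑ a, 𝔼 ε, (g ε - g (flipAt a ε)) ^ 2 := by
  induction k with
  | zero => simp [cubeEnt]
  | succ k ih =>
    set gt : (Fin k → Bool) → ℝ := fun ε => g (Fin.cons true ε) with hgt
    set gf : (Fin k → Bool) → ℝ := fun ε => g (Fin.cons false ε) with hgf
    have ht := ih gt
    have hf := ih gf
    have h0 := sq_sub_sqrt_le gt gf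
    have hGt : 0 ≤ 𝔼 i, gt i ^ 2 := expect_nonneg' fun i => sq_nonneg _
    have hGf : 0 ≤ 𝔼 i, gf i ^ 2 := expect_nonneg' fun i => sq_nonneg _
    have h2 := two_point_entropy (sqrt_nonneg (𝔼 i, gt i ^ 2)) (sqrt_nonneg (𝔼 i, gf i ^ 2))
    rw [sq_sqrt hGt, sq_sqrt hGf] at h2
    have hsum : ∑ a, 𝔼 ε, (g ε - g (flipAt a ε)) ^ 2
        = 𝔼 ε, (gt ε - gf ε) ^ 2 + (∑ a, 𝔼 ε, (gt ε - gt (flipAt a ε)) ^ 2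
          + ∑ a, 𝔼 ε, (gf ε - gf (flipAt a ε)) ^ 2) / 2 := by
      rw [Fin.sum_univ_succ, ← Finset.sum_add_distrib, Finset.sum_div]
      congr 1
      · rw [expect_cons]
        simp only [flipAt_zero_cons, Bool.not_true, Bool.not_false]
        rw [Finset.expect_congr (g := fun ε => (gt ε - gf ε) ^ 2) rfl
          (fun ε _ => by ring : ∀ ε ∈ Finset.univ,
            (g (Fin.cons false ε) - g (Fin.cons true ε)) ^ 2 = (gt ε - gf ε) ^ 2)]
        ring
      · refine Finset.sum_congr rfl fun a _ => ?_
        rw [expect_cons]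
        simp only [flipAt_succ_cons, hgt, hgf]
    rw [hsum]
    unfold cubeEnt at ht hf ⊢
    rw [expect_cons, expect_cons (fun ε => g ε ^ 2)]
    simp only [hgt, hgf] at *
    linarith

/-- Entropy dominates the second moment of functions that are small in mean. -/
lemma le_cubeEnt_sq {V : Type*} [Fintype V] [DecidableEq V] (d : (V → Bool) → ℝ) {A : ℝ}
    (hA : 0 < A) :
    (𝔼 ε, d ε ^ 2) * (log A + 1) - A * (𝔼 ε, |d ε|) ^ 2 ≤ cubeEnt (fun ε => d ε ^ 2) := by
  have hx : 0 ≤ 𝔼 ε, d ε ^ 2 := expect_nonneg' fun i => sq_nonneg _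
  set x := 𝔼 ε, d ε ^ 2 with hxdef
  set s := 𝔼 ε, |d ε| with hs
  rcases eq_or_lt_of_le hx with h0 | hpos
  · have hd : ∀ ε, d ε = 0 := by
      intro ε
      have h1 : 𝔼 ε, d ε ^ 2 = 0 := by rw [← hxdef, ← h0]
      rw [Fintype.expect_eq_sum_div_card, div_eq_zero_iff] at h1
      rcases h1 with h1 | h1
      · rw [Finset.sum_eq_zero_iff_of_nonneg (fun i _ => sq_nonneg _)] at h1
        exact pow_eq_zero_iff (two_ne_zero) |>.1 (h1 ε (Finset.mem_univ _))
      · simp at h1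
    have : cubeEnt (fun ε => d ε ^ 2) = 0 := by simp [cubeEnt, hd]
    rw [this, ← h0]
    nlinarith [mul_nonneg hA.le (sq_nonneg s)]
  set τ := √(x * A) with hτ
  have hτp : 0 < τ := sqrt_pos.2 (by positivity)
  have hτsq : τ ^ 2 = x * A := sq_sqrt (by positivity)
  have hlog : 2 * log τ = log x + log A := by
    rw [← log_mul hpos.ne' hA.ne', ← hτsq, log_pow]; norm_num
  have hpt : ∀ ε, d ε ^ 2 * (2 * log τ + 2) - 2 * τ * |d ε| ≤ d ε ^ 2 * log (d ε ^ 2) := by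
    intro ε
    rcases eq_or_ne (d ε) 0 with h | h
    · simp [h]
    have hv : 0 < |d ε| := abs_pos.2 h
    rw [← sq_abs (d ε)]
    set v := |d ε|
    have h1 := one_sub_inv_le_log_of_pos (show 0 < v / τ by positivity)
    rw [log_div hv.ne' hτp.ne', inv_div] at h1
    rw [log_pow]
    have h2 := mul_le_mul_of_nonneg_left h1 (show 0 ≤ 2 * v ^ 2 by positivity)
    have h3 : 2 * v ^ 2 * (1 - τ / v) = 2 * v ^ 2 - 2 * τ * v := by field_simp
    push_cast
    linarith
  have hE := expect_mono hpt
  rw [Finset.expect_sub_distrib, ← Finset.expect_mul, ← Finset.mul_expect, ← hxdef, ← hs] at hE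
  unfold cubeEnt
  rw [← hxdef]
  rw [hlog] at hE
  nlinarith [sq_nonneg (τ * τ - A * s), sq_nonneg (τ - A * s), hE, hτsq,
    mul_self_nonneg (τ - A * s), div_nonneg (sq_nonneg (τ - A * s)) hA.le,
    (by field_simp : (τ - A * s) ^ 2 / A * A = (τ - A * s) ^ 2),
    (by rw [sub_sq, hτsq]; field_simp :
      (τ - A * s) ^ 2 / A = x - 2 * τ * s + A * s ^ 2)]

/-- An `L¹`-`L²` variance inequality on the cube `{±1}ᵏ`. -/
lemma cube_variance_fin (k : ℕ) (u : (Fin k → Bool) → ℝ) {A : ℝ} (hA : 0 < A) :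
    (𝔼 ε, u ε ^ 2 - (𝔼 ε, u ε) ^ 2) * (log A + 1)
      ≤ ∑ a, 𝔼 ε, (u ε - u (flipAt a ε)) ^ 2
        + A / 4 * ∑ a, (𝔼 ε, |u ε - u (flipAt a ε)|) ^ 2 := by
  induction k with
  | zero => simp
  | succ k ih =>
    set ut : (Fin k → Bool) → ℝ := fun ε => u (Fin.cons true ε) with hut
    set uf : (Fin k → Bool) → ℝ := fun ε => u (Fin.cons false ε) with huf
    set w : (Fin k → Bool) → ℝ := fun ε => (ut ε + uf ε) / 2 with hw
    set d : (Fin k → Bool) → ℝ := fun ε => (ut ε - uf ε) / 2 with hd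
    have h1 := ih w
    have h2 := (le_cubeEnt_sq d hA).trans (cubeEnt_sq_le_fin k d)
    have hsq : 𝔼 ε, u ε ^ 2 = 𝔼 ε, w ε ^ 2 + 𝔼 ε, d ε ^ 2 := by
      rw [expect_cons, ← Finset.expect_add_distrib, ← Finset.expect_add_distrib,
        Finset.expect_div]
      exact Finset.expect_congr rfl fun ε _ => by simp only [hw, hd, hut, huf]; ring
    have hm : 𝔼 ε, u ε = 𝔼 ε, w ε := by
      rw [expect_cons, ← Finset.expect_add_distrib, Finset.expect_div]
    have h3 : ∑ a, 𝔼 ε, (u ε - u (flipAt a ε)) ^ 2 = 4 * 𝔼 ε, d ε ^ 2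
        + (∑ a, 𝔼 ε, (w ε - w (flipAt a ε)) ^ 2 + ∑ a, 𝔼 ε, (d ε - d (flipAt a ε)) ^ 2) := by
      rw [Fin.sum_univ_succ, ← Finset.sum_add_distrib]
      congr 1
      · rw [expect_cons, ← Finset.expect_add_distrib, Finset.expect_div, Finset.mul_expect]
        refine Finset.expect_congr rfl fun ε _ => ?_
        simp only [flipAt_zero_cons, Bool.not_true, Bool.not_false, hd, hut, huf]
        ring
      · refine Finset.sum_congr rfl fun a _ => ?_
        rw [expect_cons, ← Finset.expect_add_distrib, ← Finset.expect_add_distrib,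
          Finset.expect_div]
        refine Finset.expect_congr rfl fun ε _ => ?_
        simp only [flipAt_succ_cons, hw, hd, hut, huf]
        ring
    have h4 : 4 * (𝔼 ε, |d ε|) ^ 2 + ∑ a, (𝔼 ε, |w ε - w (flipAt a ε)|) ^ 2
        ≤ ∑ a, (𝔼 ε, |u ε - u (flipAt a ε)|) ^ 2 := by
      rw [Fin.sum_univ_succ]
      refine add_le_add (le_of_eq ?_) (Finset.sum_le_sum fun a _ => ?_)
      · rw [expect_cons]
        simp only [flipAt_zero_cons, Bool.not_true, Bool.not_false]
        have e1 : 𝔼 ε : Fin k → Bool, |u (Fin.cons true ε) - u (Fin.cons false ε)|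
            = 2 * 𝔼 ε, |d ε| := by
          rw [Finset.mul_expect]
          refine Finset.expect_congr rfl fun ε _ => ?_
          simp only [hd, hut, huf, abs_div, abs_two]
          ring
        simp only [abs_sub_comm (u (Fin.cons false _)), e1]
        ring
      · refine pow_le_pow_left₀ (expect_nonneg' fun _ => abs_nonneg _) ?_ 2
        rw [expect_cons, ← Finset.expect_add_distrib, Finset.expect_div]
        refine expect_mono fun ε => ?_
        simp only [flipAt_succ_cons, hw, hut, huf]
        rw [show ∀ p q r s : ℝ, (p + q) / 2 - (r + s) / 2 = ((p - r) + (q - s)) / 2 by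
          intros; ring, abs_div, abs_two]
        gcongr
        exact abs_add_le _ _
    have h5 : 0 ≤ 𝔼 ε, d ε ^ 2 := expect_nonneg' fun _ => sq_nonneg _
    rw [hsq, hm, h3]
    nlinarith [mul_le_mul_of_nonneg_left h4 hA.le]

lemma flipAt_comp {V W : Type*} [DecidableEq V] [DecidableEq W] (e : V ≃ W) (a : V)
    (ε : W → Bool) : flipAt (e a) ε ∘ e = flipAt a (ε ∘ e) := by
  ext b
  simp [flipAt, Function.update_apply]

lemma expect_comp_equiv {V W : Type*} [Fintype V] [DecidableEq V] [Fintype W] [DecidableEq W]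
    (e : V ≃ W) (g : (V → Bool) → ℝ) : 𝔼 ε : W → Bool, g (ε ∘ e) = 𝔼 ε, g ε :=
  Fintype.expect_equiv (Equiv.arrowCongr e.symm (Equiv.refl _)) _ _ fun ε => by
    congr

lemma cubeEnt_sq_le {V : Type*} [Fintype V] [DecidableEq V] (g : (V → Bool) → ℝ) :
    cubeEnt (fun ε => g ε ^ 2) ≤ ∑ a, 𝔼 ε, (g ε - g (flipAt a ε)) ^ 2 := by
  have h := cubeEnt_sq_le_fin _ fun ε => g (ε ∘ Fintype.equivFin V)
  rw [← (Fintype.equivFin V).sum_comp] at h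
  unfold cubeEnt at h ⊢
  simp only [flipAt_comp] at h
  rw [expect_comp_equiv _ fun ε => g ε ^ 2, expect_comp_equiv _ fun ε => g ε ^ 2 * log (g ε ^ 2)]
    at h
  refine h.trans_eq (Finset.sum_congr rfl fun a _ => ?_)
  exact expect_comp_equiv _ fun ε => (g ε - g (flipAt a ε)) ^ 2

lemma cube_variance {V : Type*} [Fintype V] [DecidableEq V] (u : (V → Bool) → ℝ) {A : ℝ}
    (hA : 0 < A) :
    (𝔼 ε, u ε ^ 2 - (𝔼 ε, u ε) ^ 2) * (log A + 1)
      ≤ ∑ a, 𝔼 ε, (u ε - u (flipAt a ε)) ^ 2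
        + A / 4 * ∑ a, (𝔼 ε, |u ε - u (flipAt a ε)|) ^ 2 := by
  have h := cube_variance_fin _ (fun ε => u (ε ∘ Fintype.equivFin V)) hA
  rw [← (Fintype.equivFin V).sum_comp, ← (Fintype.equivFin V).sum_comp] at h
  simp only [flipAt_comp] at h
  rw [expect_comp_equiv _ fun ε => u ε ^ 2, expect_comp_equiv _ u] at h
  refine h.trans_eq ?_
  congr 1
  · refine Finset.sum_congr rfl fun a _ => ?_
    exact expect_comp_equiv _ fun ε => (u ε - u (flipAt a ε)) ^ 2
  · congr 1
    refine Finset.sum_congr rfl fun a _ => ?_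
    rw [expect_comp_equiv _ fun ε => |u ε - u (flipAt a ε)|]

/-- The positive part of the discrete derivative of `F` in direction `a`. -/
noncomputable def dropAt {V : Type*} [DecidableEq V] (F : (V → Bool) → ℝ) (a : V)
    (ε : V → Bool) : ℝ :=
  max (F ε - F (flipAt a ε)) 0

lemma dropAt_nonneg {V : Type*} [DecidableEq V] (F : (V → Bool) → ℝ) (a : V)
    (ε : V → Bool) : 0 ≤ dropAt F a ε := le_max_right _ _

lemma abs_exp_sub_exp_le {θ x y b : ℝ} (hxy : y ≤ x) (hb : |θ| * (x - y) ≤ b) :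
    |exp (θ * x) - exp (θ * y)| ≤ |θ| * exp b * (exp (θ * x) * (x - y)) := by
  have key : ∀ s t : ℝ, exp s - exp t ≤ exp s * (s - t) := by
    intro s t
    have h1 := add_one_le_exp (t - s)
    have h2 : exp t = exp s * exp (t - s) := by rw [← exp_add]; congr 1; ring
    have h3 := exp_pos s
    nlinarith
  have h0 : 0 ≤ x - y := by linarith
  have hθ := abs_nonneg θ
  have hb0 : 0 ≤ b := le_trans (by positivity) hb
  have hle : exp (θ * y) ≤ exp b * exp (θ * x) := by
    rw [← exp_add]
    apply exp_le_exp.2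
    have := neg_abs_le (θ * (x - y))
    rw [abs_mul, abs_of_nonneg h0] at this
    linarith
  have h1 : exp (θ * x) ≤ exp b * exp (θ * x) := by
    have := one_le_exp hb0
    nlinarith [exp_pos (θ * x)]
  have hd : |θ * (x - y)| = |θ| * (x - y) := by rw [abs_mul, abs_of_nonneg h0]
  rw [abs_le']
  constructor
  · have h2 := key (θ * x) (θ * y)
    have h3 : θ * x - θ * y ≤ |θ| * (x - y) := by
      rw [← hd, ← mul_sub]; exact le_abs_self _
    calc exp (θ * x) - exp (θ * y) ≤ exp (θ * x) * (|θ| * (x - y)) :=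
          h2.trans (by gcongr)
      _ ≤ (exp b * exp (θ * x)) * (|θ| * (x - y)) := by gcongr
      _ = _ := by ring
  · have h2 := key (θ * y) (θ * x)
    have h3 : θ * y - θ * x ≤ |θ| * (x - y) := by
      rw [← hd]; have := neg_abs_le (θ * (x - y)); linarith
    calc -(exp (θ * x) - exp (θ * y)) ≤ exp (θ * y) * (|θ| * (x - y)) := by
          rw [neg_sub]; exact h2.trans (by gcongr)
      _ ≤ (exp b * exp (θ * x)) * (|θ| * (x - y)) := by gcongr
      _ = _ := by ring

lemma abs_exp_flip_le {V : Type*} [DecidableEq V] (F : (V → Bool) → ℝ) {θ β : ℝ}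
    (hβ : ∀ a ε, dropAt F a ε ≤ 2 * β) (hθ : |θ| * β ≤ 1 / 2) (a : V) (ε : V → Bool) :
    |exp (θ / 2 * F ε) - exp (θ / 2 * F (flipAt a ε))|
      ≤ |θ| / 2 * exp (1 / 2) * (exp (θ / 2 * F ε) * dropAt F a ε
        + exp (θ / 2 * F (flipAt a ε)) * dropAt F a (flipAt a ε)) := by
  have habs : |θ / 2| = |θ| / 2 := by rw [abs_div, abs_of_pos (by norm_num : (0 : ℝ) < 2)]
  have aux : ∀ ε, F (flipAt a ε) ≤ F ε →
      |exp (θ / 2 * F ε) - exp (θ / 2 * F (flipAt a ε))|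
      ≤ |θ| / 2 * exp (1 / 2) * (exp (θ / 2 * F ε) * dropAt F a ε) := by
    intro ε h
    have h1 : dropAt F a ε = F ε - F (flipAt a ε) := max_eq_left (by linarith)
    have h2 := hβ a ε
    have := abs_exp_sub_exp_le (θ := θ / 2) (b := 1 / 2) h (by
      rw [habs, ← h1]
      calc |θ| / 2 * dropAt F a ε ≤ |θ| / 2 * (2 * β) := by gcongr
        _ ≤ 1 / 2 := by linarith)
    rwa [habs, ← h1] at this
  rcases le_total (F (flipAt a ε)) (F ε) with h | h
  · refine (aux ε h).trans ?_
    have := dropAt_nonneg F a (flipAt a ε)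
    gcongr
    exact le_add_of_nonneg_right (by positivity)
  · have h3 := aux (flipAt a ε) (by rwa [flipAt_flipAt])
    rw [flipAt_flipAt, abs_sub_comm] at h3
    refine h3.trans ?_
    have := dropAt_nonneg F a ε
    gcongr
    exact le_add_of_nonneg_left (by positivity)

lemma dropAt_mul_dropAt_flip {V : Type*} [DecidableEq V] (F : (V → Bool) → ℝ) (a : V)
    (ε : V → Bool) : dropAt F a ε * dropAt F a (flipAt a ε) = 0 := by
  unfold dropAt
  rw [flipAt_flipAt]
  rcases le_total (F (flipAt a ε)) (F ε) with h | h
  · rw [max_eq_right (a := F (flipAt a ε) - F ε) (by linarith), mul_zero]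
  · rw [max_eq_right (by linarith), zero_mul]

lemma expect_exp_flip_sq_le {V : Type*} [Fintype V] [DecidableEq V] (F : (V → Bool) → ℝ)
    {θ β : ℝ} (hβ : ∀ a ε, dropAt F a ε ≤ 2 * β) (hθ : |θ| * β ≤ 1 / 2)
    (h2 : ∀ ε, ∑ a, dropAt F a ε ^ 2 ≤ 4) :
    ∑ a, 𝔼 ε, (exp (θ / 2 * F ε) - exp (θ / 2 * F (flipAt a ε))) ^ 2
      ≤ 6 * θ ^ 2 * 𝔼 ε, exp (θ * F ε) := by
  set c := |θ| / 2 * exp (1 / 2) with hc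
  have hc2 : c ^ 2 * 8 ≤ 6 * θ ^ 2 := by
    have : exp (1 / 2) ^ 2 = exp 1 := by rw [← exp_nat_mul]; norm_num
    rw [hc, mul_pow, div_pow, sq_abs, this]
    have := exp_one_lt_d9
    nlinarith [sq_nonneg θ]
  have hpt : ∀ a ε, (exp (θ / 2 * F ε) - exp (θ / 2 * F (flipAt a ε))) ^ 2
      ≤ c ^ 2 * (exp (θ * F ε) * dropAt F a ε ^ 2)
        + c ^ 2 * (exp (θ * F (flipAt a ε)) * dropAt F a (flipAt a ε) ^ 2) := by
    intro a ε
    have h := abs_exp_flip_le F hβ hθ a ε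
    have h0 := dropAt_mul_dropAt_flip F a ε
    have h' := pow_le_pow_left₀ (abs_nonneg _) h 2
    rw [sq_abs] at h'
    refine h'.trans (le_of_eq ?_)
    have e : ∀ x : ℝ, exp (θ * x) = exp (θ / 2 * x) ^ 2 := fun x => by
      rw [← exp_nat_mul]; congr 1; push_cast; ring
    rw [e, e]
    linear_combination (2 * c ^ 2 * exp (θ / 2 * F ε) * exp (θ / 2 * F (flipAt a ε))) * h0
  calc ∑ a, 𝔼 ε, (exp (θ / 2 * F ε) - exp (θ / 2 * F (flipAt a ε))) ^ 2
      ≤ ∑ a, (2 * c ^ 2 * 𝔼 ε, exp (θ * F ε) * dropAt F a ε ^ 2) := by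
        refine Finset.sum_le_sum fun a _ => ?_
        refine (expect_mono (hpt a)).trans (le_of_eq ?_)
        rw [Finset.expect_add_distrib,
          expect_flipAt a fun ε => c ^ 2 * (exp (θ * F ε) * dropAt F a ε ^ 2),
          ← Finset.mul_expect]
        ring
    _ = 2 * c ^ 2 * 𝔼 ε, exp (θ * F ε) * ∑ a, dropAt F a ε ^ 2 := by
        rw [← Finset.mul_sum, ← Finset.expect_sum_comm]
        simp only [Finset.mul_sum]
    _ ≤ 2 * c ^ 2 * 𝔼 ε, exp (θ * F ε) * 4 := by
        gcongr
        exact h2 _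
    _ = (c ^ 2 * 8) * 𝔼 ε, exp (θ * F ε) := by
        rw [← Finset.expect_mul]; ring
    _ ≤ _ := by
        gcongr

lemma expect_abs_exp_flip_le {V : Type*} [Fintype V] [DecidableEq V] (F : (V → Bool) → ℝ)
    {θ β : ℝ} (hβ : ∀ a ε, dropAt F a ε ≤ 2 * β) (hθ : |θ| * β ≤ 1 / 2) (a : V) :
    𝔼 ε, |exp (θ / 2 * F ε) - exp (θ / 2 * F (flipAt a ε))|
      ≤ 2 * |θ| * 𝔼 ε, exp (θ / 2 * F ε) * dropAt F a ε := by
  have he : exp (1 / 2) ≤ 2 := by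
    have h : exp (1 / 2) ^ 2 = exp 1 := by rw [← exp_nat_mul]; norm_num
    have := exp_one_lt_d9
    nlinarith [exp_pos (1 / 2)]
  have h0 : 0 ≤ 𝔼 ε, exp (θ / 2 * F ε) * dropAt F a ε :=
    expect_nonneg' fun ε => mul_nonneg (exp_pos _).le (dropAt_nonneg F a ε)
  calc 𝔼 ε, |exp (θ / 2 * F ε) - exp (θ / 2 * F (flipAt a ε))|
      ≤ |θ| / 2 * exp (1 / 2) * (2 * 𝔼 ε, exp (θ / 2 * F ε) * dropAt F a ε) := by
        refine (expect_mono (abs_exp_flip_le F hβ hθ a)).trans (le_of_eq ?_)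
        rw [← Finset.mul_expect, Finset.expect_add_distrib,
          expect_flipAt a fun ε => exp (θ / 2 * F ε) * dropAt F a ε]
        ring
    _ ≤ |θ| / 2 * 2 * (2 * 𝔼 ε, exp (θ / 2 * F ε) * dropAt F a ε) := by gcongr
    _ = _ := by ring

/-- The variance bound behind superconcentration. -/
lemma variance_exp_le {V : Type*} [Fintype V] [DecidableEq V] (F : (V → Bool) → ℝ)
    {θ β B κ A : ℝ} (hβ : ∀ a ε, dropAt F a ε ≤ 2 * β) (hθ : |θ| * β ≤ 1 / 2)
    (h2 : ∀ ε, ∑ a, dropAt F a ε ^ 2 ≤ 4) (h1 : ∀ ε, ∑ a, dropAt F a ε ≤ B)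
    (hκ : ∀ a, 𝔼 ε, dropAt F a ε ^ 2 ≤ 4 * κ) (hB : 0 ≤ B)
    (hA : 1 < A) (hAB : A * √κ * B ≤ 2) :
    (𝔼 ε, exp (θ * F ε)) - (𝔼 ε, exp (θ / 2 * F ε)) ^ 2
      ≤ 10 / log A * θ ^ 2 * 𝔼 ε, exp (θ * F ε) := by
  have hsq : ∀ ε, exp (θ / 2 * F ε) ^ 2 = exp (θ * F ε) := fun ε => by
    rw [← exp_nat_mul]; congr 1; push_cast; ring
  set Z := 𝔼 ε, exp (θ * F ε) with hZ
  have hZ0 : 0 ≤ Z := expect_nonneg' fun ε => (exp_pos _).le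
  have hV := cube_variance (fun ε => exp (θ / 2 * F ε)) (by linarith : 0 < A)
  simp only [hsq] at hV
  rw [← hZ] at hV
  have hlog : 0 < log A := log_pos hA
  set v : V → ℝ := fun a => 𝔼 ε, exp (θ / 2 * F ε) * dropAt F a ε with hv
  have hv0 : ∀ a, 0 ≤ v a := fun a =>
    expect_nonneg' fun ε => mul_nonneg (exp_pos _).le (dropAt_nonneg F a ε)
  have hv1 : ∀ a, v a ≤ √Z * (2 * √κ) := by
    intro a
    have h := expect_mul_sq_le (fun ε => exp (θ / 2 * F ε)) (dropAt F a)
    simp only [hsq] at h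
    have h' : v a ^ 2 ≤ Z * (4 * κ) := h.trans (mul_le_mul_of_nonneg_left (hκ a) hZ0)
    have h3 : √Z * (2 * √κ) = √(Z * (4 * κ)) := by
      rw [sqrt_mul hZ0, sqrt_mul (by norm_num)]
      rw [show (4 : ℝ) = 2 ^ 2 by norm_num, sqrt_sq (by norm_num)]
    rw [h3]
    exact le_sqrt_of_sq_le h'
  have hv2 : ∑ a, v a ≤ √Z * B := by
    have e : ∑ a, v a = 𝔼 ε, exp (θ / 2 * F ε) * ∑ a, dropAt F a ε := by
      rw [hv, ← Finset.expect_sum_comm]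
      simp only [Finset.mul_sum]
    rw [e]
    calc 𝔼 ε, exp (θ / 2 * F ε) * ∑ a, dropAt F a ε
        ≤ 𝔼 ε, exp (θ / 2 * F ε) * B :=
          expect_mono fun ε => by gcongr; exact h1 ε
      _ = (𝔼 ε, exp (θ / 2 * F ε) * 1) * B := by simp [← Finset.expect_mul]
      _ ≤ √Z * B := by
          gcongr
          apply le_sqrt_of_sq_le
          have h := expect_mul_sq_le (fun ε => exp (θ / 2 * F ε)) (fun _ => 1)
          simp only [hsq] at h
          simpa using h
  have hv3 : ∑ a, v a ^ 2 ≤ Z * (2 * √κ * B) := by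
    calc ∑ a, v a ^ 2 ≤ ∑ a, √Z * (2 * √κ) * v a := by
          refine Finset.sum_le_sum fun a _ => ?_
          rw [sq]
          exact mul_le_mul_of_nonneg_right (hv1 a) (hv0 a)
      _ = √Z * (2 * √κ) * ∑ a, v a := by rw [Finset.mul_sum]
      _ ≤ √Z * (2 * √κ) * (√Z * B) := by gcongr
      _ = (√Z * √Z) * (2 * √κ * B) := by ring
      _ = _ := by rw [mul_self_sqrt hZ0]
  have hT1 := expect_exp_flip_sq_le F hβ hθ h2
  have hT2 : A / 4 * ∑ a, (𝔼 ε, |exp (θ / 2 * F ε) - exp (θ / 2 * F (flipAt a ε))|) ^ 2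
      ≤ 4 * θ ^ 2 * Z := by
    calc A / 4 * ∑ a, (𝔼 ε, |exp (θ / 2 * F ε) - exp (θ / 2 * F (flipAt a ε))|) ^ 2
        ≤ A / 4 * ∑ a, (2 * |θ| * v a) ^ 2 := by
          gcongr with a
          exact expect_abs_exp_flip_le F hβ hθ a
      _ = A * θ ^ 2 * ∑ a, v a ^ 2 := by
          simp only [mul_pow, sq_abs]
          rw [← Finset.mul_sum]; ring
      _ ≤ A * θ ^ 2 * (Z * (2 * √κ * B)) := by gcongr
      _ = (A * √κ * B) * (2 * θ ^ 2 * Z) := by ring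
      _ ≤ 2 * (2 * θ ^ 2 * Z) := by gcongr
      _ = _ := by ring
  have hvar : 0 ≤ Z - (𝔼 ε, exp (θ / 2 * F ε)) ^ 2 := by
    have h := expect_mul_sq_le (fun ε => exp (θ / 2 * F ε)) (fun _ => 1)
    simp only [hsq] at h
    simpa using h
  rw [show 10 / log A * θ ^ 2 * Z = (10 * θ ^ 2 * Z) / log A by ring, le_div_iff₀ hlog]
  nlinarith

lemma expect_exp_pos {V : Type*} [Fintype V] [DecidableEq V] (G : (V → Bool) → ℝ) :
    0 < 𝔼 ε, exp (G ε) :=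
  Finset.expect_pos (fun _ _ => exp_pos _) Finset.univ_nonempty

/-- Herbst's argument on the cube. -/
lemma herbst_cube {V : Type*} [Fintype V] [DecidableEq V] (G : (V → Bool) → ℝ) {c θ₀ : ℝ}
    (hEnt : ∀ θ, 0 < θ → θ ≤ θ₀ →
      cubeEnt (fun ε => exp (θ * G ε)) ≤ c * θ ^ 2 * 𝔼 ε, exp (θ * G ε))
    (hθ₀ : 0 < θ₀) :
    𝔼 ε, exp (θ₀ * G ε) ≤ exp (θ₀ * (𝔼 ε, G ε) + c * θ₀ ^ 2) := by
  set Z : ℝ → ℝ := fun θ => 𝔼 ε, exp (θ * G ε) with hZ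
  set Z' : ℝ → ℝ := fun θ => 𝔼 ε, G ε * exp (θ * G ε) with hZ'
  have hpos : ∀ θ, 0 < Z θ := fun θ => expect_exp_pos fun ε => θ * G ε
  have hder : ∀ θ, HasDerivAt Z (Z' θ) θ := by
    intro θ
    simp only [hZ, hZ', Fintype.expect_eq_sum_div_card]
    refine HasDerivAt.div_const ?_ _
    refine HasDerivAt.fun_sum fun ε _ => ?_
    have := ((hasDerivAt_id θ).mul_const (G ε)).exp
    simpa [mul_comm] using this
  have hφ : ∀ θ, HasDerivAt (fun θ => log (Z θ)) (Z' θ / Z θ) θ := fun θ =>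
    (hder θ).log (hpos θ).ne'
  have hZ0 : Z 0 = 1 := by simp [hZ]
  have hent : ∀ θ, cubeEnt (fun ε => exp (θ * G ε)) = θ * Z' θ - Z θ * log (Z θ) := by
    intro θ
    simp only [cubeEnt, log_exp, hZ', hZ, Finset.mul_expect]
    congr 1
    exact Finset.expect_congr rfl fun ε _ => by ring
  set H : ℝ → ℝ := fun θ => log (Z θ) / θ - c * θ with hH
  have hHd : ∀ θ, 0 < θ → HasDerivAt H ((Z' θ / Z θ * θ - log (Z θ) * 1) / θ ^ 2 - c) θ := by
    intro θ hθ
    have h1 := (hφ θ).div (hasDerivAt_id θ) hθ.ne'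
    have h2 := (hasDerivAt_id θ).const_mul c
    simpa using h1.fun_sub h2
  have hanti : AntitoneOn H (Set.Ioc 0 θ₀) := by
    apply antitoneOn_of_deriv_nonpos (convex_Ioc 0 θ₀)
    · exact fun θ hθ => (hHd θ hθ.1).continuousAt.continuousWithinAt
    · rw [interior_Ioc]
      exact fun θ hθ => (hHd θ hθ.1).differentiableAt.differentiableWithinAt
    · rw [interior_Ioc]
      intro θ hθ
      rw [(hHd θ hθ.1).deriv]
      have h1 := hEnt θ hθ.1 hθ.2.le
      rw [hent] at h1
      have hp := hpos θ
      change _ ≤ c * θ ^ 2 * Z θ at h1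
      rw [sub_nonpos, div_le_iff₀ (pow_pos hθ.1 2), mul_one, div_mul_eq_mul_div, sub_le_iff_le_add,
        div_le_iff₀ hp]
      linarith
  have hlim : Filter.Tendsto H (𝓝[>] 0) (𝓝 (𝔼 ε, G ε)) := by
    have h1 := (hφ 0).tendsto_slope_zero_right
    simp only [zero_add, hZ0, log_one, sub_zero, div_one] at h1
    have h2 : Filter.Tendsto (fun θ : ℝ => c * θ) (𝓝[>] 0) (𝓝 0) := by
      have : Filter.Tendsto (fun θ : ℝ => c * θ) (𝓝 0) (𝓝 (c * 0)) :=
        (continuous_const.mul continuous_id).tendsto 0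
      rw [mul_zero] at this
      exact this.mono_left nhdsWithin_le_nhds
    have h3 := h1.sub h2
    have h4 : Z' 0 - 0 = 𝔼 ε, G ε := by simp [hZ']
    rw [h4] at h3
    refine h3.congr fun θ => ?_
    simp [hH, div_eq_inv_mul]
  have hle : H θ₀ ≤ 𝔼 ε, G ε := by
    refine ge_of_tendsto hlim ?_
    filter_upwards [Ioo_mem_nhdsGT hθ₀] with θ hθ
    exact hanti ⟨hθ.1, hθ.2.le⟩ ⟨hθ₀, le_rfl⟩ hθ.2.le
  have h5 : log (Z θ₀) ≤ θ₀ * (𝔼 ε, G ε) + c * θ₀ ^ 2 := by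
    have h6 : log (Z θ₀) / θ₀ ≤ (𝔼 ε, G ε) + c * θ₀ := by simp only [hH] at hle; linarith
    rw [div_le_iff₀ hθ₀] at h6
    linarith
  calc Z θ₀ = exp (log (Z θ₀)) := (exp_log (hpos _)).symm
    _ ≤ _ := exp_le_exp.2 h5

/-- Subgaussian moment generating function of a function on the cube with small gradient. -/
lemma mgf_cube_le {V : Type*} [Fintype V] [DecidableEq V] (F : (V → Bool) → ℝ)
    {θ β : ℝ} (hβ : ∀ a ε, dropAt F a ε ≤ 2 * β) (hβ0 : 0 ≤ β) (hθ : |θ| * β ≤ 1 / 2)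
    (h2 : ∀ ε, ∑ a, dropAt F a ε ^ 2 ≤ 4) :
    𝔼 ε, exp (θ * (F ε - 𝔼 ε, F ε)) ≤ exp (6 * θ ^ 2) := by
  have hent : ∀ t : ℝ, |t| * β ≤ 1 / 2 →
      cubeEnt (fun ε => exp (t * F ε)) ≤ 6 * t ^ 2 * 𝔼 ε, exp (t * F ε) := by
    intro t ht
    have h := cubeEnt_sq_le fun ε => exp (t / 2 * F ε)
    have hsq : ∀ ε, exp (t / 2 * F ε) ^ 2 = exp (t * F ε) := fun ε => by
      rw [← exp_nat_mul]; congr 1; push_cast; ring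
    simp only [hsq] at h
    exact h.trans (expect_exp_flip_sq_le F hβ ht h2)
  have hmain : 𝔼 ε, exp (θ * F ε) ≤ exp (θ * (𝔼 ε, F ε) + 6 * θ ^ 2) := by
    rcases lt_trichotomy θ 0 with h | h | h
    · have := herbst_cube (fun ε => - F ε) (c := 6) (θ₀ := -θ) (fun t ht0 ht => by
        have h3 := hent (-t) (by
          rw [abs_neg, abs_of_pos ht0]
          rw [abs_of_neg h] at hθ
          exact (mul_le_mul_of_nonneg_right ht hβ0).trans hθ)
        simpa using h3) (by linarith)
      simpa [Finset.expect_neg_distrib] using this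
    · subst h; simp
    · refine herbst_cube F (fun t ht0 ht => hent t ?_) h
      rw [abs_of_pos ht0]
      rw [abs_of_pos h] at hθ
      exact (mul_le_mul_of_nonneg_right ht hβ0).trans hθ
  have e : ∀ ε, exp (θ * (F ε - 𝔼 ε, F ε)) = exp (θ * F ε) * exp (-(θ * 𝔼 ε, F ε)) := fun ε => by
    rw [← exp_add]; congr 1; ring
  simp only [e]
  rw [← Finset.expect_mul]
  calc _ ≤ exp (θ * (𝔼 ε, F ε) + 6 * θ ^ 2) * exp (-(θ * 𝔼 ε, F ε)) := by gcongr
    _ = _ := by rw [← exp_add]; congr 1; ring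

lemma expect_sq_le_of_cube {V : Type*} [Fintype V] [DecidableEq V] (F : (V → Bool) → ℝ)
    {β : ℝ} (hβ : ∀ a ε, dropAt F a ε ≤ 2 * β) (hβ0 : 0 ≤ β) (hβ1 : β ≤ 1 / 2)
    (h2 : ∀ ε, ∑ a, dropAt F a ε ^ 2 ≤ 4) :
    𝔼 ε, F ε ^ 2 ≤ (𝔼 ε, F ε) ^ 2 + 4 * exp 6 := by
  set m := 𝔼 ε, F ε with hm
  have h1 := mgf_cube_le F (θ := 1) hβ hβ0 (by simpa using hβ1) h2
  have h3 := mgf_cube_le F (θ := -1) hβ hβ0 (by simpa using hβ1) h2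
  rw [← hm] at h1 h3
  have key : ∀ x : ℝ, x ^ 2 ≤ 2 * (exp (1 * x) + exp (-1 * x)) := by
    intro x
    have h := quadratic_le_exp_of_nonneg (abs_nonneg x)
    rw [sq_abs] at h
    have h4 : exp |x| ≤ exp (1 * x) + exp (-1 * x) := by
      rw [one_mul, neg_one_mul]
      rcases abs_cases x with ⟨h, _⟩ | ⟨h, _⟩ <;> rw [h] <;>
        linarith [exp_pos x, exp_pos (-x)]
    linarith [abs_nonneg x]
  have h5 := expect_mono fun ε => key (F ε - m)
  rw [← Finset.mul_expect, Finset.expect_add_distrib] at h5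
  have h6 : 𝔼 ε, (F ε - m) ^ 2 = 𝔼 ε, F ε ^ 2 - m ^ 2 := by
    have : ∀ ε, (F ε - m) ^ 2 = F ε ^ 2 - (2 * m) * F ε + m ^ 2 := fun ε => by ring
    simp only [this]
    rw [Finset.expect_add_distrib, Finset.expect_sub_distrib, ← Finset.mul_expect, ← hm]
    simp
    ring
  norm_num at h1 h3 h5
  linarith

/-- Superconcentration: a function on the cube all of whose influences are small. -/
lemma mgf_cube_le_of_small_influence {V : Type*} [Fintype V] [DecidableEq V]
    (F : (V → Bool) → ℝ) {θ β B κ A : ℝ} (hβ : ∀ a ε, dropAt F a ε ≤ 2 * β) (hβ0 : 0 ≤ β)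
    (h2 : ∀ ε, ∑ a, dropAt F a ε ^ 2 ≤ 4) (h1 : ∀ ε, ∑ a, dropAt F a ε ≤ B)
    (hκ : ∀ a, 𝔼 ε, dropAt F a ε ^ 2 ≤ 4 * κ) (hB : 0 ≤ B)
    (hA : 1 < A) (hAB : A * √κ * B ≤ 2) (hθ : |θ| * β ≤ 1 / 2)
    (hD : 10 / log A * θ ^ 2 ≤ 1 / 2) :
    𝔼 ε, exp (θ * (F ε - 𝔼 ε, F ε)) ≤ exp (40 / log A * θ ^ 2) := by
  set m := 𝔼 ε, F ε with hm
  set D := 10 / log A with hDdef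
  have hD0 : 0 ≤ D := div_nonneg (by norm_num) (log_pos hA).le
  set ψ : ℝ → ℝ := fun θ => 𝔼 ε, exp (θ * (F ε - m)) with hψ
  have hψ0 : ∀ θ, 0 < ψ θ := fun θ => expect_exp_pos fun ε => θ * (F ε - m)
  have hshift : ∀ t, ψ t = (𝔼 ε, exp (t * F ε)) * exp (-(t * m)) := by
    intro t
    simp only [hψ]
    rw [Finset.expect_mul]
    exact Finset.expect_congr rfl fun ε _ => by rw [← exp_add]; congr 1; ring
  have step : ∀ t, |t| * β ≤ 1 / 2 → D * t ^ 2 ≤ 1 / 2 →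
      ψ t ≤ exp (2 * (D * t ^ 2)) * ψ (t / 2) ^ 2 := by
    intro t ht htD
    have hv := variance_exp_le F hβ ht h2 h1 hκ hB hA hAB
    rw [← hDdef] at hv
    have h3 : (1 - D * t ^ 2) * ψ t ≤ ψ (t / 2) ^ 2 := by
      rw [hshift, hshift, mul_pow, ← exp_nat_mul,
        show ((2 : ℕ) : ℝ) * -(t / 2 * m) = -(t * m) by push_cast; ring, ← mul_assoc]
      gcongr
      linarith
    have h4 : 1 ≤ exp (2 * (D * t ^ 2)) * (1 - D * t ^ 2) := by
      have h5 := add_one_le_exp (2 * (D * t ^ 2))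
      have h6 : 0 ≤ D * t ^ 2 := by positivity
      have h7 : (2 * (D * t ^ 2) + 1) * (1 - D * t ^ 2)
          ≤ exp (2 * (D * t ^ 2)) * (1 - D * t ^ 2) :=
        mul_le_mul_of_nonneg_right h5 (by linarith)
      nlinarith
    calc ψ t = 1 * ψ t := (one_mul _).symm
      _ ≤ exp (2 * (D * t ^ 2)) * (1 - D * t ^ 2) * ψ t :=
        mul_le_mul_of_nonneg_right h4 (hψ0 t).le
      _ = exp (2 * (D * t ^ 2)) * ((1 - D * t ^ 2) * ψ t) := by ring
      _ ≤ _ := by gcongr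
  have ind : ∀ k : ℕ, ∀ t, |t| * β ≤ 1 / 2 → D * t ^ 2 ≤ 1 / 2 →
      ψ t ≤ exp (6 * t ^ 2 / 2 ^ k + 4 * (D * t ^ 2)) := by
    intro k
    induction k with
    | zero =>
      intro t ht htD
      refine (mgf_cube_le F hβ hβ0 ht h2).trans (exp_le_exp.2 ?_)
      have : 0 ≤ D * t ^ 2 := by positivity
      simp only [pow_zero, div_one]
      linarith
    | succ k ih =>
      intro t ht htD
      have habs : |t / 2| = |t| / 2 := by rw [abs_div, abs_of_pos (by norm_num : (0 : ℝ) < 2)]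
      have ih' := ih (t / 2) (by
        rw [habs]; have : 0 ≤ |t| * β := by positivity
        linarith) (by
        have : 0 ≤ D * t ^ 2 := by positivity
        nlinarith)
      calc ψ t ≤ exp (2 * (D * t ^ 2)) * ψ (t / 2) ^ 2 := step t ht htD
        _ ≤ exp (2 * (D * t ^ 2)) * exp (6 * (t / 2) ^ 2 / 2 ^ k + 4 * (D * (t / 2) ^ 2)) ^ 2 := by
            have := (hψ0 (t / 2)).le
            gcongr
        _ = _ := by
            rw [← exp_nat_mul, ← exp_add]
            congr 1
            push_cast
            rw [pow_succ]
            field_simp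
            ring
  have hlim : Filter.Tendsto (fun k : ℕ => exp (6 * θ ^ 2 / 2 ^ k + 4 * (D * θ ^ 2)))
      Filter.atTop (𝓝 (exp (0 + 4 * (D * θ ^ 2)))) := by
    refine (continuous_exp.tendsto _).comp (Filter.Tendsto.add_const _ ?_)
    have := (tendsto_pow_atTop_nhds_zero_of_lt_one (r := (1 / 2 : ℝ)) (by norm_num)
      (by norm_num)).const_mul (6 * θ ^ 2)
    rw [mul_zero] at this
    refine this.congr fun k => ?_
    rw [div_pow, one_pow]; ring
  have := ge_of_tendsto' hlim fun k => ind k θ hθ hD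
  refine this.trans (exp_le_exp.2 (le_of_eq ?_))
  rw [hDdef]; ring

/-- A seminorm, as a predicate on functions. -/
structure IsSemi {E : Type*} [AddCommGroup E] [Module ℝ E] (f : E → ℝ) : Prop where
  add_le : ∀ x y, f (x + y) ≤ f x + f y
  smul : ∀ (r : ℝ) x, f (r • x) = |r| * f x

namespace IsSemi

variable {E : Type*} [AddCommGroup E] [Module ℝ E] {f : E → ℝ}

lemma zero (hf : IsSemi f) : f 0 = 0 := by simpa using hf.smul 0 0

lemma neg (hf : IsSemi f) (x : E) : f (-x) = f x := by simpa using hf.smul (-1) x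

lemma nonneg (hf : IsSemi f) (x : E) : 0 ≤ f x := by
  have h := hf.add_le x (-x)
  rw [add_neg_cancel, hf.zero, hf.neg] at h
  linarith

lemma sub_le (hf : IsSemi f) (x y : E) : f x - f y ≤ f (x - y) := by
  have h := hf.add_le (x - y) y
  rw [sub_add_cancel] at h
  linarith

lemma abs_sub_le (hf : IsSemi f) (x y : E) : |f x - f y| ≤ f (x - y) := by
  rw [abs_sub_le_iff]
  refine ⟨hf.sub_le x y, ?_⟩
  have h := hf.sub_le y x
  have e := hf.neg (y - x)
  rw [neg_sub] at e
  linarith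

lemma comp (hf : IsSemi f) {E' : Type*} [AddCommGroup E'] [Module ℝ E'] (T : E' →ₗ[ℝ] E) :
    IsSemi fun x => f (T x) :=
  ⟨fun x y => by rw [map_add]; exact hf.add_le _ _, fun r x => by rw [map_smul]; exact hf.smul _ _⟩

/-- Convexity at the midpoint of `x + v` and `x - v`. -/
lemma two_mul_le (hf : IsSemi f) (x v : E) : 2 * f x ≤ f (x + v) + f (x - v) := by
  have h := hf.add_le (x + v) (x - v)
  have e : x + v + (x - v) = (2 : ℝ) • x := by rw [two_smul]; abel
  rw [e, hf.smul] at h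
  simpa using h

/-- Hahn-Banach. -/
lemma exists_subgradient (hf : IsSemi f) (x₀ : E) :
    ∃ y : E →ₗ[ℝ] ℝ, y x₀ = f x₀ ∧ ∀ x, |y x| ≤ f x := by
  have key : ∃ y : E →ₗ[ℝ] ℝ, y x₀ = f x₀ ∧ ∀ x, y x ≤ f x := by
    by_cases h0 : x₀ = 0
    · exact ⟨0, by simp [h0, hf.zero], fun x => by simpa using hf.nonneg x⟩
    let p : E →ₗ.[ℝ] ℝ := LinearPMap.mkSpanSingleton x₀ (f x₀) h0
    obtain ⟨g, hg1, hg2⟩ := exists_extension_of_le_sublinear p f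
      (fun c hc x => by rw [hf.smul, abs_of_pos hc]) hf.add_le (by
        rintro ⟨x, hx⟩
        obtain ⟨c, rfl⟩ := Submodule.mem_span_singleton.1 hx
        have : p ⟨c • x₀, hx⟩ = c • f x₀ := LinearPMap.mkSpanSingleton'_apply _ _ _ _ _
        rw [this, hf.smul, smul_eq_mul]
        exact mul_le_mul_of_nonneg_right (le_abs_self c) (hf.nonneg _))
    refine ⟨g, ?_, hg2⟩
    have hx : x₀ ∈ p.domain := Submodule.mem_span_singleton_self x₀
    rw [hg1 ⟨x₀, hx⟩]
    exact LinearPMap.mkSpanSingleton_apply ℝ ℝ h0 (f x₀)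
  obtain ⟨y, h1, h2⟩ := key
  refine ⟨y, h1, fun x => abs_le'.2 ⟨h2 x, ?_⟩⟩
  have := h2 (-x)
  rwa [map_neg, hf.neg] at this

end IsSemi

/-- The sign `±1` encoded by a Boolean. -/
def sgn (b : Bool) : ℝ := if b then 1 else -1

lemma sgn_not (b : Bool) : sgn (!b) = - sgn b := by cases b <;> simp [sgn]

lemma abs_sgn (b : Bool) : |sgn b| = 1 := by cases b <;> simp [sgn]

/-- The Rademacher sum `∑_{a ∈ S} ε_a w_a`. -/
def signSum {E V : Type*} [AddCommGroup E] [Module ℝ E] (w : V → E) (S : Finset V)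
    (ε : V → Bool) : E :=
  ∑ a ∈ S, sgn (ε a) • w a

section

variable {E V : Type*} [AddCommGroup E] [Module ℝ E] [DecidableEq V] (w : V → E)
  {f : E → ℝ}

lemma signSum_erase {S : Finset V} {a : V} (ha : a ∈ S) (ε : V → Bool) :
    signSum w S ε = signSum w (S.erase a) ε + sgn (ε a) • w a := by
  rw [signSum, ← Finset.sum_erase_add _ _ ha, signSum]

lemma signSum_flipAt_of_notMem {S : Finset V} {a : V} (ha : a ∉ S) (ε : V → Bool) :
    signSum w S (flipAt a ε) = signSum w S ε := by
  refine Finset.sum_congr rfl fun b hb => ?_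
  have hne : b ≠ a := fun h => ha (h ▸ hb)
  rw [flipAt, Function.update_of_ne hne]

lemma signSum_flipAt {S : Finset V} {a : V} (ha : a ∈ S) (ε : V → Bool) :
    signSum w S (flipAt a ε) = signSum w (S.erase a) ε - sgn (ε a) • w a := by
  rw [signSum_erase w ha, signSum_flipAt_of_notMem w (Finset.notMem_erase a S)]
  simp [flipAt, sgn_not, sub_eq_add_neg]

lemma dropAt_signSum_of_notMem {S : Finset V} {a : V} (ha : a ∉ S) (ε : V → Bool) :
    dropAt (fun ε => f (signSum w S ε)) a ε = 0 := by
  simp [dropAt, signSum_flipAt_of_notMem w ha]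

lemma exists_dropAt_le (hf : IsSemi f) (S : Finset V) (ε : V → Bool) :
    ∃ y : E →ₗ[ℝ] ℝ, (∀ x, |y x| ≤ f x) ∧
      ∀ a ∈ S, dropAt (fun ε => f (signSum w S ε)) a ε ≤ 2 * |y (w a)| := by
  obtain ⟨y, h1, h2⟩ := hf.exists_subgradient (signSum w S ε)
  refine ⟨y, h2, fun a ha => max_le ?_ (by positivity)⟩
  have h3 := (le_abs_self _).trans (h2 (signSum w S (flipAt a ε)))
  have h4 : signSum w S ε - signSum w S (flipAt a ε) = (2 * sgn (ε a)) • w a := by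
    rw [signSum_flipAt w ha, signSum_erase w ha, mul_smul, two_smul]; abel
  calc f (signSum w S ε) - f (signSum w S (flipAt a ε))
      ≤ y (signSum w S ε) - y (signSum w S (flipAt a ε)) := by rw [h1]; linarith
    _ = 2 * sgn (ε a) * y (w a) := by rw [← map_sub, h4, map_smul, smul_eq_mul]
    _ ≤ |2 * sgn (ε a) * y (w a)| := le_abs_self _
    _ = 2 * |y (w a)| := by rw [abs_mul, abs_mul, abs_sgn]; norm_num

lemma dropAt_signSum_le (hf : IsSemi f) {β : ℝ} (hβ : ∀ a, f (w a) ≤ β) (hβ0 : 0 ≤ β)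
    (S : Finset V) (a : V) (ε : V → Bool) :
    dropAt (fun ε => f (signSum w S ε)) a ε ≤ 2 * β := by
  by_cases ha : a ∈ S
  · obtain ⟨y, h1, h2⟩ := exists_dropAt_le w hf S ε
    have := (h1 (w a)).trans (hβ a)
    have := h2 a ha
    linarith
  · rw [dropAt_signSum_of_notMem w ha]; linarith

lemma sum_dropAt_sq_le [Fintype V] (hf : IsSemi f)
    (h : ∀ c : V → ℝ, f (∑ a, c a • w a) ≤ √(∑ a, c a ^ 2)) (S : Finset V) (ε : V → Bool) :
    ∑ a, dropAt (fun ε => f (signSum w S ε)) a ε ^ 2 ≤ 4 := by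
  obtain ⟨y, h1, h2⟩ := exists_dropAt_le w hf S ε
  have h3 : ∑ a, y (w a) ^ 2 ≤ 1 := by
    have h4 := (le_abs_self _).trans ((h1 _).trans (h fun a => y (w a)))
    have e : y (∑ a, y (w a) • w a) = ∑ a, y (w a) ^ 2 := by
      rw [map_sum]; exact Finset.sum_congr rfl fun a _ => by rw [map_smul, smul_eq_mul, sq]
    rw [e] at h4
    have h5 : 0 ≤ ∑ a, y (w a) ^ 2 := Finset.sum_nonneg fun a _ => sq_nonneg _
    have h6 := sq_sqrt h5
    nlinarith [sqrt_nonneg (∑ a, y (w a) ^ 2)]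
  calc ∑ a, dropAt (fun ε => f (signSum w S ε)) a ε ^ 2
      ≤ ∑ a, 4 * y (w a) ^ 2 := by
        refine Finset.sum_le_sum fun a _ => ?_
        by_cases ha : a ∈ S
        · calc _ ≤ (2 * |y (w a)|) ^ 2 := pow_le_pow_left₀ (dropAt_nonneg _ _ _) (h2 a ha) 2
            _ = _ := by rw [mul_pow, sq_abs]; norm_num
        · rw [dropAt_signSum_of_notMem w ha, zero_pow two_ne_zero]; positivity
    _ = 4 * ∑ a, y (w a) ^ 2 := by rw [Finset.mul_sum]
    _ ≤ 4 := by linarith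

lemma sum_dropAt_le [Fintype V] (hf : IsSemi f) (S : Finset V) {K : ℝ}
    (h : ∀ c : V → ℝ, (∀ a, |c a| ≤ 1) → f (∑ a ∈ S, c a • w a) ≤ K) (ε : V → Bool) :
    ∑ a, dropAt (fun ε => f (signSum w S ε)) a ε ≤ 2 * K := by
  obtain ⟨y, h1, h2⟩ := exists_dropAt_le w hf S ε
  have h3 : ∑ a ∈ S, |y (w a)| ≤ K := by
    have h4 := (le_abs_self _).trans ((h1 _).trans (h (fun a => SignType.sign (y (w a)))
      fun a => by rcases lt_trichotomy (y (w a)) 0 with h | h | h <;> simp [h]))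
    rw [map_sum] at h4
    refine le_trans (Finset.sum_le_sum fun a _ => ?_) h4
    rw [map_smul, smul_eq_mul, sign_mul_self]
  calc ∑ a, dropAt (fun ε => f (signSum w S ε)) a ε
      = ∑ a ∈ S, dropAt (fun ε => f (signSum w S ε)) a ε := by
        symm
        exact Finset.sum_subset (Finset.subset_univ S) fun a _ ha =>
          dropAt_signSum_of_notMem w ha ε
    _ ≤ ∑ a ∈ S, 2 * |y (w a)| := Finset.sum_le_sum h2
    _ ≤ 2 * K := by rw [← Finset.mul_sum]; linarith

lemma expect_signSum_erase_le [Fintype V] (hf : IsSemi f) (S : Finset V) (a : V) :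
    𝔼 ε, f (signSum w (S.erase a) ε) ≤ 𝔼 ε, f (signSum w S ε) := by
  by_cases ha : a ∈ S
  · have h : 𝔼 ε, 2 * f (signSum w (S.erase a) ε)
        ≤ 𝔼 ε, (f (signSum w S ε) + f (signSum w S (flipAt a ε))) :=
      expect_mono fun ε => by
        rw [signSum_flipAt w ha, signSum_erase w ha]
        exact hf.two_mul_le _ _
    rw [← Finset.mul_expect, Finset.expect_add_distrib,
      expect_flipAt a fun ε => f (signSum w S ε)] at h
    linarith
  · rw [Finset.erase_eq_of_notMem ha]

lemma expect_signSum_mono [Fintype V] (hf : IsSemi f) {S S' : Finset V} (h : S ⊆ S') :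
    𝔼 ε, f (signSum w S ε) ≤ 𝔼 ε, f (signSum w S' ε) := by
  obtain ⟨U, rfl⟩ : ∃ U, S = S' \ U := ⟨S' \ S, by simp [Finset.inter_eq_right.2 h]⟩
  clear h
  induction U using Finset.induction_on with
  | empty => simp
  | insert a U _ ih =>
    rw [Finset.sdiff_insert]
    exact (expect_signSum_erase_le w hf _ a).trans ih

lemma influence_le [Fintype V] (hf : IsSemi f) {S : Finset V} {a : V} (ha : a ∈ S) :
    𝔼 ε, dropAt (fun ε => f (signSum w S ε)) a ε ^ 2
      ≤ 4 * (𝔼 ε, f (signSum w S ε) ^ 2 - 𝔼 ε, f (signSum w (S.erase a) ε) ^ 2) := by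
  have h : 𝔼 ε, (dropAt (fun ε => f (signSum w S ε)) a ε ^ 2
        + 4 * f (signSum w (S.erase a) ε) ^ 2)
      ≤ 𝔼 ε, (2 * f (signSum w S ε) ^ 2 + 2 * f (signSum w S (flipAt a ε)) ^ 2) :=
    expect_mono fun ε => by
      have h1 := hf.two_mul_le (signSum w (S.erase a) ε) (sgn (ε a) • w a)
      rw [← signSum_flipAt w ha, ← signSum_erase w ha] at h1
      have h2 := hf.nonneg (signSum w (S.erase a) ε)
      have h3 : dropAt (fun ε => f (signSum w S ε)) a ε ^ 2
          ≤ (f (signSum w S ε) - f (signSum w S (flipAt a ε))) ^ 2 := by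
        unfold dropAt
        rcases le_total (f (signSum w S ε) - f (signSum w S (flipAt a ε))) 0 with h | h
        · rw [max_eq_right h, zero_pow two_ne_zero]; positivity
        · rw [max_eq_left h]
      nlinarith
  rw [Finset.expect_add_distrib, Finset.expect_add_distrib, ← Finset.mul_expect,
    ← Finset.mul_expect, ← Finset.mul_expect,
    expect_flipAt a fun ε => f (signSum w S ε) ^ 2] at h
  linarith

/-- Removing the coordinates of large influence. -/
lemma exists_small_influence [Fintype V] (hf : IsSemi f) (S₀ : Finset V) {κ : ℝ} (hκ : 0 < κ) :
    ∃ S ⊆ S₀, (∀ a, 𝔼 ε, dropAt (fun ε => f (signSum w S ε)) a ε ^ 2 ≤ 4 * κ) ∧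
      κ * ((S₀.card : ℝ) - S.card) ≤ 𝔼 ε, f (signSum w S₀ ε) ^ 2 := by
  obtain ⟨S, hS, hmin⟩ := Finset.exists_min_image S₀.powerset
    (fun S => 𝔼 ε, f (signSum w S ε) ^ 2 - κ * S.card) ⟨∅, by simp⟩
  rw [Finset.mem_powerset] at hS
  refine ⟨S, hS, fun a => ?_, ?_⟩
  · by_cases ha : a ∈ S
    · refine (influence_le w hf ha).trans ?_
      have h := hmin (S.erase a) (by
        rw [Finset.mem_powerset]; exact (Finset.erase_subset a S).trans hS)
      have hc : ((S.erase a).card : ℝ) = S.card - 1 := by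
        rw [Finset.card_erase_of_mem ha, Nat.cast_sub (Finset.card_pos.2 ⟨a, ha⟩)]; simp
      rw [hc] at h
      linarith
    · simp only [dropAt_signSum_of_notMem w ha]
      simp [hκ.le]
  · have h := hmin S₀ (Finset.mem_powerset_self S₀)
    have h0 : 0 ≤ 𝔼 ε, f (signSum w S ε) ^ 2 := expect_nonneg' fun ε => sq_nonneg _
    linarith

end

lemma contraction_pointwise {J I : Type*} [Nonempty J] [DecidableEq I] (σ : Finset I)
    (p p' : J → I → ℝ) (M : ℝ) (hp' : ∀ j i, |p' j i| ≤ M) {a : I} (ha : a ∈ σ)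
    (hne : ∀ j i, i ≠ a → p j i = p' j i) (hpa : ∀ j, p j a = |p' j a|) (ε : I → Bool) :
    (⨆ j, ∑ i ∈ σ, sgn (ε i) * p j i) + (⨆ j, ∑ i ∈ σ, sgn (flipAt a ε i) * p j i)
      ≤ (⨆ j, ∑ i ∈ σ, sgn (ε i) * p' j i)
        + ⨆ j, ∑ i ∈ σ, sgn (flipAt a ε i) * p' j i := by
  have hbdd : ∀ ε : I → Bool, BddAbove (Set.range fun j => ∑ i ∈ σ, sgn (ε i) * p' j i) := by
    intro ε
    refine ⟨∑ i ∈ σ, M, ?_⟩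
    rintro _ ⟨j, rfl⟩
    refine Finset.sum_le_sum fun i _ => (le_abs_self _).trans ?_
    rw [abs_mul, abs_sgn, one_mul]
    exact hp' j i
  set h : J → ℝ := fun j => ∑ i ∈ σ.erase a, sgn (ε i) * p' j i with hh
  have e1 : ∀ j, ∑ i ∈ σ, sgn (ε i) * p' j i = h j + sgn (ε a) * p' j a := fun j =>
    (Finset.sum_erase_add _ _ ha).symm
  have e0 : ∀ j, ∑ i ∈ σ.erase a, sgn (flipAt a ε i) * p' j i = h j := fun j =>
    Finset.sum_congr rfl fun i hi => by
      rw [flipAt, Function.update_of_ne (Finset.ne_of_mem_erase hi)]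
  have e2 : ∀ j, ∑ i ∈ σ, sgn (flipAt a ε i) * p' j i = h j - sgn (ε a) * p' j a := fun j => by
    rw [← Finset.sum_erase_add _ _ ha, e0]
    simp [flipAt, sgn_not, sub_eq_add_neg]
  have e3 : ∀ ε : I → Bool, ∀ j, ∑ i ∈ σ.erase a, sgn (ε i) * p j i
      = ∑ i ∈ σ.erase a, sgn (ε i) * p' j i := fun ε j =>
    Finset.sum_congr rfl fun i hi => by rw [hne j i (Finset.ne_of_mem_erase hi)]
  have e4 : ∀ j, ∑ i ∈ σ, sgn (ε i) * p j i = h j + sgn (ε a) * |p' j a| := fun j => by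
    rw [← Finset.sum_erase_add _ _ ha, e3, hpa]
  have e5 : ∀ j, ∑ i ∈ σ, sgn (flipAt a ε i) * p j i = h j - sgn (ε a) * |p' j a| := fun j => by
    rw [← Finset.sum_erase_add _ _ ha, e3, e0, hpa]
    simp [flipAt, sgn_not, sub_eq_add_neg]
  have b1 := hbdd ε
  have b2 := hbdd (flipAt a ε)
  simp only [e1, e2, e4, e5] at b1 b2 ⊢
  refine ciSup_add_ciSup_le fun j j' => ?_
  have h1 := le_ciSup b1 j
  have h2 := le_ciSup b1 j'
  have h3 := le_ciSup b2 j
  have h4 := le_ciSup b2 j'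
  have h5 := abs_abs_sub_abs_le (p' j a) (p' j' a)
  have h6 := abs_le.1 h5
  rcases abs_cases (p' j a - p' j' a) with ⟨h7, _⟩ | ⟨h7, _⟩ <;>
    rcases Bool.eq_false_or_eq_true (ε a) with h8 | h8 <;>
    simp only [h8, sgn, if_true, if_false, Bool.false_eq_true] at * <;> linarith

/-- The contraction principle for absolute values. -/
lemma contraction_abs {J I : Type*} [Nonempty J] [Fintype I] [DecidableEq I] (σ : Finset I)
    (y : J → I → ℝ) (M : ℝ) (hy : ∀ j i, |y j i| ≤ M) :
    𝔼 ε : I → Bool, (⨆ j, ∑ i ∈ σ, sgn (ε i) * |y j i|)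
      ≤ 𝔼 ε : I → Bool, ⨆ j, ∑ i ∈ σ, sgn (ε i) * y j i := by
  have key : ∀ u ⊆ σ, 𝔼 ε : I → Bool, (⨆ j, ∑ i ∈ σ, sgn (ε i) * |y j i|)
      ≤ 𝔼 ε : I → Bool, ⨆ j, ∑ i ∈ σ, sgn (ε i) * (if i ∈ u then y j i else |y j i|) := by
    intro u
    induction u using Finset.induction_on with
    | empty => simp
    | insert a u hau ih =>
      intro hu
      refine (ih ((Finset.subset_insert a u).trans hu)).trans ?_
      have h := expect_mono fun ε => contraction_pointwise σ
        (fun j i => if i ∈ u then y j i else |y j i|)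
        (fun j i => if i ∈ insert a u then y j i else |y j i|) M
        (fun j i => by split_ifs <;> simp [hy]) (hu (Finset.mem_insert_self a u))
        (fun j i hi => by simp [hi]) (fun j => by simp [hau]) ε
      rw [Finset.expect_add_distrib, Finset.expect_add_distrib,
        expect_flipAt a fun ε => ⨆ j, ∑ i ∈ σ, sgn (ε i) * (if i ∈ u then y j i else |y j i|),
        expect_flipAt a fun ε =>
          ⨆ j, ∑ i ∈ σ, sgn (ε i) * (if i ∈ insert a u then y j i else |y j i|)] at h
      linarith
  refine (key σ subset_rfl).trans (le_of_eq ?_)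
  refine Finset.expect_congr rfl fun ε _ => ?_
  congr 1
  ext j
  exact Finset.sum_congr rfl fun i hi => by rw [if_pos hi]

lemma halving_step {E I : Type*} [AddCommGroup E] [Module ℝ E] [Fintype I] [DecidableEq I]
    {f : E → ℝ} (hf : IsSemi f) (e : I → E) (σ : Finset I) {K r : ℝ}
    (hr : 𝔼 ε, f (signSum e σ ε) ≤ r)
    (hK : ∀ c : I → ℝ, (∀ i, |c i| ≤ 1) → f (∑ i ∈ σ, c i • e i) ≤ K) :
    ∃ σ' ⊆ σ, σ.card ≤ 2 * σ'.card ∧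
      ∀ c : I → ℝ, (∀ i, |c i| ≤ 1) → f (∑ i ∈ σ', c i • e i) ≤ K / 2 + r := by
  let J := {y : E →ₗ[ℝ] ℝ // ∀ x, |y x| ≤ f x}
  have j₀ : J := ⟨0, fun x => by simpa using hf.nonneg x⟩
  have : Nonempty J := ⟨j₀⟩
  set M := ∑ i, f (e i) with hM
  have hy : ∀ (j : J) i, |j.1 (e i)| ≤ M := fun j i => (j.2 _).trans
    (Finset.single_le_sum (f := fun i => f (e i)) (fun i _ => hf.nonneg _) (Finset.mem_univ i))
  set R : (I → Bool) → ℝ := fun ε => ⨆ j : J, ∑ i ∈ σ, sgn (ε i) * |j.1 (e i)| with hR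
  have hbdd : ∀ ε : I → Bool,
      BddAbove (Set.range fun j : J => ∑ i ∈ σ, sgn (ε i) * |j.1 (e i)|) := by
    intro ε
    refine ⟨∑ i ∈ σ, M, ?_⟩
    rintro _ ⟨j, rfl⟩
    refine Finset.sum_le_sum fun i _ => (le_abs_self _).trans ?_
    rw [abs_mul, abs_sgn, one_mul, abs_abs]
    exact hy j i
  have hle : ∀ ε (j : J), ∑ i ∈ σ, sgn (ε i) * |j.1 (e i)| ≤ R ε := fun ε j =>
    le_ciSup (hbdd ε) j
  have hR0 : ∀ ε, 0 ≤ R ε := fun ε => by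
    have := hle ε ⟨0, fun x => by simpa using hf.nonneg x⟩
    simpa using this
  have hER : 𝔼 ε, R ε ≤ r := by
    refine ((contraction_abs σ (fun (j : J) i => j.1 (e i)) M hy).trans ?_).trans hr
    refine expect_mono fun ε => ciSup_le fun j => ?_
    have : ∑ i ∈ σ, sgn (ε i) * j.1 (e i) = j.1 (signSum e σ ε) := by
      simp [signSum, map_sum]
    rw [this]
    exact (le_abs_self _).trans (j.2 _)
  obtain ⟨ε, hε⟩ : ∃ ε : I → Bool, R ε + R (fun i => !ε i) ≤ 2 * r := by
    by_contra! hcon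
    have h1 : 𝔼 ε : I → Bool, R (fun i => !ε i) = 𝔼 ε, R ε :=
      Fintype.expect_equiv ⟨fun (ε : I → Bool) i => !ε i, fun ε i => !ε i,
        fun ε => by simp, fun ε => by simp⟩ _ _ fun _ => rfl
    have h2 : 𝔼 ε : I → Bool, 2 * r < 𝔼 ε, (R ε + R (fun i => !ε i)) :=
      Finset.expect_lt_expect (fun ε _ => (hcon ε).le) ⟨fun _ => true, by simp, hcon _⟩
    rw [Finset.expect_add_distrib, h1] at h2
    simp at h2
    linarith
  have hhalf : ∀ ε : I → Bool, R ε ≤ 2 * r → ∀ c : I → ℝ, (∀ i, |c i| ≤ 1) →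
      f (∑ i ∈ σ with ε i = true, c i • e i) ≤ K / 2 + r := by
    intro ε hε c hc
    obtain ⟨y, hy1, hy2⟩ := hf.exists_subgradient (∑ i ∈ σ with ε i = true, c i • e i)
    have h1 := hle ε ⟨y, hy2⟩
    have h2 : ∑ i ∈ σ, |y (e i)| ≤ K := by
      have h4 := (le_abs_self _).trans ((hy2 _).trans (hK (fun a => SignType.sign (y (e a)))
        fun a => by rcases lt_trichotomy (y (e a)) 0 with h | h | h <;> simp [h]))
      rw [map_sum] at h4
      refine le_trans (Finset.sum_le_sum fun a _ => ?_) h4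
      rw [map_smul, smul_eq_mul, sign_mul_self]
    have h3 : ∑ i ∈ σ with ε i = true, |y (e i)|
        = (∑ i ∈ σ, |y (e i)| + ∑ i ∈ σ, sgn (ε i) * |y (e i)|) / 2 := by
      rw [← Finset.sum_add_distrib, Finset.sum_div, Finset.sum_filter]
      refine Finset.sum_congr rfl fun i _ => ?_
      cases ε i <;> simp [sgn]
    rw [← hy1, map_sum]
    calc ∑ i ∈ σ with ε i = true, y (c i • e i)
        ≤ ∑ i ∈ σ with ε i = true, |y (e i)| := by
          refine Finset.sum_le_sum fun i _ => ?_
          rw [map_smul, smul_eq_mul]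
          refine (le_abs_self _).trans ?_
          rw [abs_mul]
          exact mul_le_of_le_one_left (abs_nonneg _) (hc i)
      _ ≤ K / 2 + r := by
          rw [h3]
          dsimp only at h1
          linarith
  have hcard := Finset.card_filter_add_card_filter_not (s := σ) fun i => ε i = true
  rcases le_total (σ.filter fun i => ε i = true).card (σ.filter fun i => ¬ ε i = true).card
    with h | h
  · refine ⟨σ.filter fun i => ¬ ε i = true, Finset.filter_subset _ _, by omega, ?_⟩
    have := hhalf (fun i => !ε i) (by linarith [hR0 ε])
    simpa using this
  · exact ⟨σ.filter fun i => ε i = true, Finset.filter_subset _ _, by omega,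
      hhalf ε (by linarith [hR0 fun i => !ε i])⟩

/-- Passing to a subset of coordinates on which the norm is bounded by a multiple of `ℓ_∞`. -/
lemma exists_linfty_subset {E I : Type*} [AddCommGroup E] [Module ℝ E] [Fintype I]
    [DecidableEq I] {f : E → ℝ} (hf : IsSemi f) (e : I → E) (σ : Finset I) {K r : ℝ}
    (hr : 𝔼 ε, f (signSum e Finset.univ ε) ≤ r)
    (hK : ∀ c : I → ℝ, (∀ i, |c i| ≤ 1) → f (∑ i ∈ σ, c i • e i) ≤ K) (k : ℕ) :
    ∃ σ' ⊆ σ, σ.card ≤ 2 ^ k * σ'.card ∧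
      ∀ c : I → ℝ, (∀ i, |c i| ≤ 1) → f (∑ i ∈ σ', c i • e i) ≤ K / 2 ^ k + 2 * r := by
  have hr0 : 0 ≤ r := (expect_nonneg' fun ε => hf.nonneg _).trans hr
  induction k with
  | zero => exact ⟨σ, subset_rfl, by simp, fun c hc => (hK c hc).trans (by simp [hr0])⟩
  | succ k ih =>
    obtain ⟨σ₁, h1, h2, h3⟩ := ih
    obtain ⟨σ₂, h4, h5, h6⟩ := halving_step hf e σ₁
      ((expect_signSum_mono e hf (Finset.subset_univ σ₁)).trans hr) h3
    refine ⟨σ₂, h4.trans h1, ?_, fun c hc => (h6 c hc).trans (le_of_eq ?_)⟩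
    · calc σ.card ≤ 2 ^ k * σ₁.card := h2
        _ ≤ 2 ^ k * (2 * σ₂.card) := by gcongr
        _ = _ := by ring
    · rw [pow_succ]; field_simp; ring

lemma euclNorm_ofLp {n : ℕ} (x : EuclideanSpace ℝ (Fin n)) : euclNorm x.ofLp = ‖x‖ := by
  simp [euclNorm, EuclideanSpace.norm_eq]

lemma continuous_euclNorm {n : ℕ} : Continuous (euclNorm (d := n)) := by
  unfold euclNorm; fun_prop

lemma abs_le_euclNorm {n : ℕ} (x : Fin n → ℝ) (i : Fin n) : |x i| ≤ euclNorm x := by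
  unfold euclNorm
  rw [← sqrt_sq_eq_abs]
  exact sqrt_le_sqrt (Finset.single_le_sum (f := fun i => x i ^ 2) (fun i _ => sq_nonneg _)
    (Finset.mem_univ i))

lemma abs_det_le_one_of_john {n : ℕ} {N : (Fin n → ℝ) → ℝ} (hJ : JohnPosition N)
    (T : (Fin n → ℝ) →ₗ[ℝ] (Fin n → ℝ)) (hT : ∀ x, euclNorm x ≤ 1 → N (T x) ≤ 1) :
    |LinearMap.det T| ≤ 1 := by
  have h := hJ.2 T 0 fun x hx => by simpa using hT x hx
  simp only [add_zero] at h
  rw [Measure.addHaar_image_linearMap] at h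
  have hpos : volume {x : Fin n → ℝ | euclNorm x ≤ 1} ≠ 0 := by
    have ho : IsOpen {x : Fin n → ℝ | euclNorm x < 1} :=
      isOpen_lt continuous_euclNorm continuous_const
    have := ho.measure_pos volume ⟨0, by simp [euclNorm]⟩
    have hsub : {x : Fin n → ℝ | euclNorm x < 1} ⊆ {x | euclNorm x ≤ 1} :=
      fun x (hx : euclNorm x < 1) => hx.le
    exact (this.trans_le (measure_mono hsub)).ne'
  have hfin : volume {x : Fin n → ℝ | euclNorm x ≤ 1} ≠ ⊤ := by
    refine ne_top_of_le_ne_top (measure_closedBall_lt_top (x := (0 : Fin n → ℝ)) (r := 1)).ne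
      (measure_mono fun x hx => ?_)
    rw [mem_closedBall_zero_iff, pi_norm_le_iff_of_nonneg zero_le_one]
    exact fun i => (abs_le_euclNorm x i).trans hx
  have h2 : ENNReal.ofReal |LinearMap.det T| ≤ 1 := by
    by_contra! hcon
    have := ENNReal.mul_lt_mul_left hpos hfin hcon
    rw [one_mul] at this
    exact absurd h (not_le.2 this)
  simpa using h2

lemma dvoretzky_rogers_step {n : ℕ} {N : (Fin n → ℝ) → ℝ} (hN : IsSemi N)
    (hle : ∀ x, N x ≤ euclNorm x) (hJ : JohnPosition N)
    (B : OrthonormalBasis (Fin n) ℝ (EuclideanSpace ℝ (Fin n))) (s : Finset (Fin n))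
    (hs : 2 * s.card ≤ n) (hn : 1 ≤ n) :
    ∃ v : EuclideanSpace ℝ (Fin n), ‖v‖ = 1 ∧ (∀ i ∈ s, inner ℝ (B i) v = 0) ∧
      1 / 4 ≤ N v.ofLp := by
  by_contra! hcon
  let L := WithLp.linearEquiv 2 ℝ (Fin n → ℝ)
  set g : EuclideanSpace ℝ (Fin n) → ℝ := fun x => N x.ofLp with hg
  have hgs : IsSemi g := hN.comp L.toLinearMap
  have hg1 : ∀ x, g x ≤ ‖x‖ := fun x => (hle _).trans_eq (euclNorm_ofLp x)
  have hg2 : ∀ x, (∀ i ∈ s, inner ℝ (B i) x = 0) → g x ≤ 1 / 4 * ‖x‖ := by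
    intro x hx
    by_cases h0 : x = 0
    · simp [h0, hgs.zero]
    have hpos := norm_pos_iff.2 h0
    have h := hcon ((‖x‖⁻¹) • x) (by rw [norm_smul, norm_inv, norm_norm, inv_mul_cancel₀ hpos.ne'])
      (fun i hi => by rw [inner_smul_right, hx i hi, mul_zero])
    change g _ < _ at h
    rw [hgs.smul, abs_inv, abs_norm, inv_mul_lt_iff₀ hpos] at h
    linarith
  set d : Fin n → ℝ := fun i => if i ∈ s then √(7 / 8) else √2 with hd
  let T := Matrix.toLin B.toBasis B.toBasis (Matrix.diagonal d)
  have hTB : ∀ i, T (B i) = d i • B i := by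
    intro i
    have := Matrix.toLin_self B.toBasis B.toBasis (Matrix.diagonal d) i
    simp only [OrthonormalBasis.coe_toBasis] at this
    rw [this]
    simp [Matrix.diagonal_apply]
  have hdet : LinearMap.det T = ∏ i, d i := by
    rw [LinearMap.det_toLin, Matrix.det_diagonal]
  have hTx : ∀ x, ‖x‖ ≤ 1 → g (T x) ≤ 1 := by
    intro x hx
    set x₁ := ∑ i ∈ s, inner ℝ (B i) x • B i with hx₁
    set x₂ := ∑ i ∈ sᶜ, inner ℝ (B i) x • B i with hx₂
    have hx12 : x = x₁ + x₂ := by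
      rw [hx₁, hx₂, Finset.sum_add_sum_compl, B.sum_repr']
    have horth : ∀ i ∈ s, inner ℝ (B i) x₂ = 0 := by
      intro i hi
      rw [hx₂, inner_sum]
      refine Finset.sum_eq_zero fun j hj => ?_
      rw [inner_smul_right, B.inner_eq_zero (by rintro rfl; exact (Finset.mem_compl.1 hj) hi),
        mul_zero]
    have h12 : inner ℝ x₁ x₂ = (0 : ℝ) := by
      rw [hx₁, sum_inner]
      exact Finset.sum_eq_zero fun i hi => by rw [real_inner_smul_left, horth i hi, mul_zero]
    have hpy : ‖x₁‖ * ‖x₁‖ + ‖x₂‖ * ‖x₂‖ ≤ 1 := by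
      rw [← norm_add_sq_eq_norm_sq_add_norm_sq_of_inner_eq_zero _ _ h12, ← hx12]
      nlinarith [norm_nonneg x]
    have hT1 : T x₁ = √(7 / 8) • x₁ := by
      rw [hx₁, map_sum, Finset.smul_sum]
      exact Finset.sum_congr rfl fun i hi => by
        rw [map_smul, hTB, smul_comm]; simp [hd, hi]
    have hT2 : T x₂ = √2 • x₂ := by
      rw [hx₂, map_sum, Finset.smul_sum]
      exact Finset.sum_congr rfl fun i hi => by
        rw [map_smul, hTB, smul_comm]; simp [hd, Finset.mem_compl.1 hi]
    have hle2 : g (T x) ≤ √(7 / 8) * ‖x₁‖ + √2 * (1 / 4 * ‖x₂‖) := by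
      rw [hx12, map_add, hT1, hT2]
      refine (hgs.add_le _ _).trans ?_
      rw [hgs.smul, hgs.smul, abs_of_nonneg (sqrt_nonneg _), abs_of_nonneg (sqrt_nonneg _)]
      gcongr
      · exact hg1 _
      · exact hg2 _ horth
    have q1 := sq_sqrt (show (0 : ℝ) ≤ 7 / 8 by norm_num)
    have q2 := sq_sqrt (show (0 : ℝ) ≤ 2 by norm_num)
    refine hle2.trans (abs_le_one_iff_mul_self_le_one.2 ?_ |> (le_abs_self _).trans)
    nlinarith [sq_nonneg (√(7 / 8) * ‖x₂‖ - √2 / 4 * ‖x₁‖)]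
  have hdet2 := abs_det_le_one_of_john hJ (L.toLinearMap ∘ₗ T ∘ₗ L.symm.toLinearMap) (by
    intro x hx
    have h := hTx (L.symm x) (by rw [← euclNorm_ofLp]; exact hx)
    exact h)
  rw [LinearMap.det_conj, hdet] at hdet2
  have hprod : (∏ i, d i) ^ 2 = (7 / 8) ^ s.card * 2 ^ (n - s.card) := by
    rw [← Finset.prod_pow, ← Finset.prod_mul_prod_compl s]
    have e1 : ∏ i ∈ s, d i ^ 2 = (7 / 8) ^ s.card := by
      rw [← Finset.prod_const]
      exact Finset.prod_congr rfl fun i hi => by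
        simp only [hd, hi, if_true]; exact sq_sqrt (by norm_num)
    have e2 : ∏ i ∈ sᶜ, d i ^ 2 = 2 ^ (n - s.card) := by
      have hc : sᶜ.card = n - s.card := by rw [Finset.card_compl, Fintype.card_fin]
      rw [← hc, ← Finset.prod_const]
      exact Finset.prod_congr rfl fun i hi => by
        simp only [hd, Finset.mem_compl.1 hi, if_false]; exact sq_sqrt (by norm_num)
    rw [e1, e2]
  have h1 : (∏ i, d i) ^ 2 ≤ 1 := by
    rw [← sq_abs]; exact pow_le_one₀ (abs_nonneg _) hdet2
  rw [hprod] at h1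
  have h2 : (7 / 8 : ℝ) ^ (n - s.card) ≤ (7 / 8) ^ s.card :=
    pow_le_pow_of_le_one (by norm_num) (by norm_num) (by omega)
  have h3 : (1 : ℝ) < (7 / 8) ^ (n - s.card) * 2 ^ (n - s.card) := by
    rw [← mul_pow]; exact one_lt_pow₀ (by norm_num) (by omega)
  have h4 : (7 / 8 : ℝ) ^ (n - s.card) * 2 ^ (n - s.card)
    ≤ (7 / 8) ^ s.card * 2 ^ (n - s.card) := by gcongr
  linarith

/-- A weak form of the Dvoretzky-Rogers lemma. -/
lemma dvoretzky_rogers {n : ℕ} {N : (Fin n → ℝ) → ℝ} (hN : IsSemi N)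
    (hle : ∀ x, N x ≤ euclNorm x) (hJ : JohnPosition N) (hn : 1 ≤ n) :
    ∃ (B : OrthonormalBasis (Fin n) ℝ (EuclideanSpace ℝ (Fin n))) (s : Finset (Fin n)),
      n ≤ 2 * s.card ∧ ∀ i ∈ s, 1 / 4 ≤ N (B i).ofLp := by
  have key : ∀ k, 2 * k ≤ n + 1 →
      ∃ (B : OrthonormalBasis (Fin n) ℝ (EuclideanSpace ℝ (Fin n))) (s : Finset (Fin n)),
        s.card = k ∧ ∀ i ∈ s, 1 / 4 ≤ N (B i).ofLp := by
    intro k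
    induction k with
    | zero => exact fun _ => ⟨EuclideanSpace.basisFun _ _, ∅, by simp, by simp⟩
    | succ k ih =>
      intro hk
      obtain ⟨B, s, hs, hB⟩ := ih (by omega)
      obtain ⟨v, hv1, hv2, hv3⟩ := dvoretzky_rogers_step hN hle hJ B s (by omega) hn
      obtain ⟨j, hj⟩ : ∃ j, j ∉ s := by
        by_contra! h
        have := Finset.eq_univ_iff_forall.2 h
        rw [this, Finset.card_fin] at hs
        omega
      have hne : ∀ i ∈ s, i ≠ j := fun i hi h => hj (h ▸ hi)
      have ho : Orthonormal ℝ ((insert j (s : Set (Fin n))).domRestrict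
          (Function.update (B : Fin n → EuclideanSpace ℝ (Fin n)) j v)) := by
        have hin : ∀ a b, (a = j ∨ a ∈ s) → (b = j ∨ b ∈ s) →
            inner ℝ (Function.update (B : Fin n → EuclideanSpace ℝ (Fin n)) j v a)
              (Function.update (B : Fin n → EuclideanSpace ℝ (Fin n)) j v b)
              = if a = b then (1 : ℝ) else 0 := by
          intro a b ha hb
          rcases ha with rfl | ha <;> rcases hb with rfl | hb
          · simp [hv1]
          · have := hne b hb
            rw [Function.update_self, Function.update_of_ne this, real_inner_comm, hv2 b hb,
              if_neg this.symm]
          · have := hne a ha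
            rw [Function.update_self, Function.update_of_ne this, hv2 a ha, if_neg this]
          · rw [Function.update_of_ne (hne a ha), Function.update_of_ne (hne b hb)]
            exact (orthonormal_iff_ite.1 B.orthonormal) a b
        rw [orthonormal_iff_ite]
        rintro ⟨a, ha⟩ ⟨b, hb⟩
        simp only [Subtype.mk.injEq]
        exact hin a b ha hb
      obtain ⟨B', hB'⟩ := ho.exists_orthonormalBasis_extension_of_card_eq (by simp)
      refine ⟨B', insert j s, by rw [Finset.card_insert_of_notMem hj, hs], fun i hi => ?_⟩
      rw [hB' i (by simpa using hi)]
      rcases Finset.mem_insert.1 hi with rfl | hi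
      · rwa [Function.update_self]
      · rw [Function.update_of_ne (hne i hi)]; exact hB i hi
  obtain ⟨B, s, hs, hB⟩ := key ((n + 1) / 2) (by omega)
  exact ⟨B, s, by omega, hB⟩

lemma abs_cos_sub_exp_le {x : ℝ} (hx : |x| ≤ 1) : |cos x - exp (-(x ^ 2 / 2))| ≤ x ^ 4 := by
  have h1 := cos_bound hx
  have hx2 : x ^ 2 ≤ 1 := by rw [← sq_abs]; exact pow_le_one₀ (abs_nonneg x) hx
  have h2 := abs_exp_sub_one_sub_id_le (x := -(x ^ 2 / 2)) (by
    rw [abs_neg, abs_of_nonneg (by positivity)]; linarith)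
  have h4 : |x| ^ 4 = x ^ 4 := by rw [← abs_pow]; exact abs_of_nonneg (by positivity)
  rw [h4] at h1
  rw [abs_le] at *
  have : 0 ≤ x ^ 4 := by positivity
  constructor <;> nlinarith [h1.1, h1.2, h2.1, h2.2]

lemma tendsto_cos_pow {q k : ℕ → ℕ} (hq : Filter.Tendsto q Filter.atTop Filter.atTop) {a : ℝ}
    (hk : ∀ j, k j ≤ q j)
    (h : Filter.Tendsto (fun j => (k j : ℝ) / q j) Filter.atTop (𝓝 a)) (t : ℝ) :
    Filter.Tendsto (fun j => cos (t / √(q j)) ^ k j) Filter.atTop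
      (𝓝 (exp (-((t ^ 2 * a) / 2)))) := by
  have hqR : Filter.Tendsto (fun j => (q j : ℝ)) Filter.atTop Filter.atTop :=
    tendsto_natCast_atTop_atTop.comp hq
  have h1 : Filter.Tendsto (fun j => exp (-((t ^ 2 * ((k j : ℝ) / q j)) / 2))) Filter.atTop
      (𝓝 (exp (-((t ^ 2 * a) / 2)))) :=
    (continuous_exp.tendsto _).comp (((h.const_mul _).div_const _).neg)
  have h2 : Filter.Tendsto (fun j => cos (t / √(q j)) ^ k j
      - exp (-((t ^ 2 * ((k j : ℝ) / q j)) / 2))) Filter.atTop (𝓝 0) := by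
    have h3 : Filter.Tendsto (fun j => t ^ 4 / (q j : ℝ)) Filter.atTop (𝓝 0) :=
      tendsto_const_nhds.div_atTop hqR
    refine squeeze_zero_norm' ?_ h3
    filter_upwards [hqR.eventually_ge_atTop (max 1 (t ^ 2))] with j hj
    have hq1 : (1 : ℝ) ≤ q j := (le_max_left _ _).trans hj
    have hq0 : (0 : ℝ) < q j := by linarith
    have hqt : t ^ 2 ≤ q j := (le_max_right _ _).trans hj
    have hx2 : (t / √(q j)) ^ 2 = t ^ 2 / q j := by rw [div_pow, sq_sqrt hq0.le]
    have hx : |t / √(q j)| ≤ 1 := by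
      rw [← sq_le_one_iff_abs_le_one, hx2]
      exact (div_le_one hq0).2 hqt
    have e : exp (-((t ^ 2 * ((k j : ℝ) / q j)) / 2))
        = exp (-((t / √(q j)) ^ 2 / 2)) ^ k j := by
      rw [← exp_nat_mul, hx2]
      congr 1
      ring
    rw [e, norm_eq_abs]
    refine (abs_pow_sub_pow_le _ _ _).trans ?_
    have hm : max |cos (t / √(q j))| |exp (-((t / √(q j)) ^ 2 / 2))| ≤ 1 := by
      refine max_le (abs_cos_le_one _) ?_
      rw [abs_of_pos (exp_pos _), exp_le_one_iff]
      linarith [sq_nonneg (t / √(q j))]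
    have hm0 : 0 ≤ max |cos (t / √(q j))| |exp (-((t / √(q j)) ^ 2 / 2))| :=
      (abs_nonneg _).trans (le_max_left _ _)
    have hkq : (k j : ℝ) ≤ q j := Nat.cast_le.2 (hk j)
    calc _ ≤ (t / √(q j)) ^ 4 * q j * 1 := by
          gcongr
          · exact abs_cos_sub_exp_le hx
          · exact pow_le_one₀ hm0 hm
      _ = t ^ 4 / q j := by
          have : (t / √(q j)) ^ 4 = (t ^ 2 / q j) ^ 2 := by rw [← hx2]; ring
          rw [this]
          field_simp
  simpa using h2.add h1

lemma expect_cexp_signSum {V : Type*} [Fintype V] [DecidableEq V] (S : Finset V) (y : V → ℝ) :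
    𝔼 ε : V → Bool, Complex.exp (((∑ a ∈ S, sgn (ε a) * y a : ℝ) : ℂ) * Complex.I)
      = ((∏ a ∈ S, cos (y a) : ℝ) : ℂ) := by
  have h1 : ∀ ε : V → Bool, Complex.exp (((∑ a ∈ S, sgn (ε a) * y a : ℝ) : ℂ) * Complex.I)
      = ∏ a, if a ∈ S then Complex.exp (((sgn (ε a) * y a : ℝ) : ℂ) * Complex.I) else 1 := by
    intro ε
    rw [Finset.prod_ite_mem, Finset.univ_inter, ← Complex.exp_sum, Complex.ofReal_sum,
      Finset.sum_mul]
  have h2 := (Fintype.prod_sum (fun (a : V) (b : Bool) =>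
    if a ∈ S then Complex.exp (((sgn b * y a : ℝ) : ℂ) * Complex.I) else 1)).symm
  simp_rw [h1]
  rw [Fintype.expect_eq_sum_div_card, h2]
  have h3 : ∀ a, (∑ b : Bool, if a ∈ S then Complex.exp (((sgn b * y a : ℝ) : ℂ) * Complex.I)
      else 1) = 2 * if a ∈ S then ((cos (y a) : ℝ) : ℂ) else 1 := by
    intro a
    by_cases ha : a ∈ S
    · simp [ha, sgn, Complex.cos]
      ring
    · simp [ha]
  simp_rw [h3]
  rw [Finset.prod_mul_distrib, Finset.prod_ite_mem, Finset.univ_inter]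
  simp

/-- The step vectors of the `q`-step simple random walk approximating a Gaussian vector. -/
noncomputable def stepVec (n q : ℕ) (a : Fin n × Fin q) : Fin n → ℝ :=
  (1 / √q) • Pi.single a.1 1

/-- The number of steps in direction `i`. -/
def fibre {n q : ℕ} (S : Finset (Fin n × Fin q)) (i : Fin n) : ℕ := {a ∈ S | a.1 = i}.card

lemma fibre_le {n q : ℕ} (S : Finset (Fin n × Fin q)) (i : Fin n) : fibre S i ≤ q := by
  have h : ({a ∈ S | a.1 = i} : Finset _) ⊆ Finset.univ.image fun k : Fin q => (i, k) := by
    intro a ha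
    rw [Finset.mem_filter] at ha
    exact Finset.mem_image.2 ⟨a.2, Finset.mem_univ _, by rw [← ha.2]⟩
  exact (Finset.card_le_card h).trans (Finset.card_image_le.trans (by simp))

lemma signSum_stepVec_apply {n q : ℕ} (S : Finset (Fin n × Fin q)) (ε) (i : Fin n) :
    signSum (stepVec n q) S ε i = ∑ a ∈ S, sgn (ε a) * (1 / √q * if a.1 = i then 1 else 0) := by
  simp [signSum, stepVec, Finset.sum_apply, Pi.single_apply, eq_comm]

lemma expect_cexp_stepVec {n q : ℕ} (S : Finset (Fin n × Fin q)) (t : Fin n → ℝ) :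
    𝔼 ε, Complex.exp (((∑ i, signSum (stepVec n q) S ε i * t i : ℝ) : ℂ) * Complex.I)
      = ((∏ i, cos (t i / √q) ^ fibre S i : ℝ) : ℂ) := by
  have h1 : ∀ ε, ∑ i, signSum (stepVec n q) S ε i * t i
      = ∑ a ∈ S, sgn (ε a) * (t a.1 / √q) := by
    intro ε
    simp_rw [signSum_stepVec_apply, Finset.sum_mul]
    rw [Finset.sum_comm]
    refine Finset.sum_congr rfl fun a _ => ?_
    rw [Finset.sum_eq_single a.1]
    · simp; ring
    · intro b _ hb
      simp [hb.symm]
    · simp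
  simp_rw [h1]
  rw [expect_cexp_signSum]
  congr 1
  rw [← Finset.prod_fiberwise S Prod.fst]
  refine Finset.prod_congr rfl fun i _ => ?_
  rw [fibre, ← Finset.prod_const]
  refine Finset.prod_congr rfl fun a ha => ?_
  rw [(Finset.mem_filter.1 ha).2]

instance isProbabilityMeasure_stdGaussian (n : ℕ) : IsProbabilityMeasure (stdGaussian n) := by
  unfold _root_.stdGaussian; infer_instance

lemma integral_cexp_stdGaussian {n : ℕ} (l t : Fin n → ℝ) :
    ∫ z, Complex.exp (((∑ i, l i * z i * t i : ℝ) : ℂ) * Complex.I) ∂stdGaussian n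
      = ((∏ i, exp (-((t i ^ 2 * l i ^ 2) / 2)) : ℝ) : ℂ) := by
  have h1 : ∀ z : Fin n → ℝ, Complex.exp (((∑ i, l i * z i * t i : ℝ) : ℂ) * Complex.I)
      = ∏ i, Complex.exp (((l i * t i : ℝ) : ℂ) * (z i : ℂ) * Complex.I) := by
    intro z
    rw [← Complex.exp_sum, Complex.ofReal_sum, Finset.sum_mul]
    congr 1
    refine Finset.sum_congr rfl fun i _ => ?_
    push_cast
    ring
  simp_rw [h1]
  rw [_root_.stdGaussian, integral_fintype_prod_eq_prod
    (f := fun i (x : ℝ) => Complex.exp (((l i * t i : ℝ) : ℂ) * (x : ℂ) * Complex.I))]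
  rw [Complex.ofReal_prod]
  refine Finset.prod_congr rfl fun i _ => ?_
  rw [← charFun_apply_real, charFun_gaussianReal]
  push_cast
  congr 1
  simp
  ring

/-- Central limit theorem for random walks with independent coordinates. -/
lemma tendsto_expect_signSum {n : ℕ} {q : ℕ → ℕ}
    (hq : Filter.Tendsto q Filter.atTop Filter.atTop)
    (S : ∀ j, Finset (Fin n × Fin (q j))) (l : Fin n → ℝ)
    (hS : ∀ i, Filter.Tendsto (fun j => (fibre (S j) i : ℝ) / q j) Filter.atTop (𝓝 (l i ^ 2)))
    (g : BoundedContinuousFunction (EuclideanSpace ℝ (Fin n)) ℝ) :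
    Filter.Tendsto (fun j => 𝔼 ε, g (WithLp.toLp 2 (signSum (stepVec n (q j)) (S j) ε)))
      Filter.atTop (𝓝 (∫ z, g (WithLp.toLp 2 (l * z)) ∂stdGaussian n)) := by
  have hm0 : Measurable fun z : Fin n → ℝ => WithLp.toLp 2 (l * z) := by fun_prop
  have hmj : ∀ j, Measurable fun ε : (Fin n × Fin (q j)) → Bool =>
      WithLp.toLp 2 (signSum (stepVec n (q j)) (S j) ε) := fun j => measurable_of_finite _
  have hp : ∀ j, IsProbabilityMeasure
      ((PMF.uniformOfFintype ((Fin n × Fin (q j)) → Bool)).toMeasure.map fun ε =>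
        WithLp.toLp 2 (signSum (stepVec n (q j)) (S j) ε)) := fun j =>
    Measure.isProbabilityMeasure_map (hmj j).aemeasurable
  let μ : ℕ → ProbabilityMeasure (EuclideanSpace ℝ (Fin n)) := fun j => ⟨_, hp j⟩
  let μ₀ : ProbabilityMeasure (EuclideanSpace ℝ (Fin n)) :=
    ⟨(stdGaussian n).map fun z => WithLp.toLp 2 (l * z),
      Measure.isProbabilityMeasure_map hm0.aemeasurable⟩
  have hE : ∀ (j : ℕ) {G : Type} [NormedAddCommGroup G] [NormedSpace ℝ G] [CompleteSpace G]
      [Module ℚ≥0 G]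
      (f : EuclideanSpace ℝ (Fin n) → G), Continuous f →
      ∫ x, f x ∂(μ j : Measure (EuclideanSpace ℝ (Fin n)))
        = (Fintype.card ((Fin n × Fin (q j)) → Bool) : ℝ)⁻¹ •
          ∑ ε, f (WithLp.toLp 2 (signSum (stepVec n (q j)) (S j) ε)) := by
    intro j G _ _ _ _ f hf
    change ∫ x, f x ∂(Measure.map _ _) = _
    rw [integral_map (hmj j).aemeasurable hf.aestronglyMeasurable, PMF.integral_eq_sum,
      Finset.smul_sum]
    simp [PMF.uniformOfFintype_apply]
  have hlim : Filter.Tendsto μ Filter.atTop (𝓝 μ₀) := by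
    refine ProbabilityMeasure.tendsto_of_tendsto_charFun fun t => ?_
    have hc : Continuous fun x : EuclideanSpace ℝ (Fin n) =>
        Complex.exp ((inner ℝ x t : ℂ) * Complex.I) := by fun_prop
    have e0 : charFun (μ₀ : Measure (EuclideanSpace ℝ (Fin n))) t
        = ((∏ i, exp (-((t i ^ 2 * l i ^ 2) / 2)) : ℝ) : ℂ) := by
      rw [charFun_apply, ← integral_cexp_stdGaussian]
      change ∫ x, _ ∂(Measure.map _ _) = _
      rw [integral_map hm0.aemeasurable hc.aestronglyMeasurable]
      simp [PiLp.inner_apply, mul_comm]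
    have ej : ∀ j, charFun (μ j : Measure (EuclideanSpace ℝ (Fin n))) t
        = ((∏ i, cos (t i / √(q j)) ^ fibre (S j) i : ℝ) : ℂ) := by
      intro j
      rw [charFun_apply, hE j _ hc, ← expect_cexp_stepVec, Fintype.expect_eq_sum_div_card]
      simp [PiLp.inner_apply, mul_comm, div_eq_mul_inv]
    simp_rw [ej]
    rw [e0]
    refine (Complex.continuous_ofReal.tendsto _).comp ?_
    exact tendsto_finsetProd _ fun i _ => tendsto_cos_pow hq (fun j => fibre_le _ i) (hS i) (t i)
  have h := (ProbabilityMeasure.tendsto_iff_forall_integral_tendsto.1 hlim) g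
  have e0 : ∫ x, g x ∂(μ₀ : Measure (EuclideanSpace ℝ (Fin n)))
      = ∫ z, g (WithLp.toLp 2 (l * z)) ∂stdGaussian n :=
    integral_map hm0.aemeasurable g.continuous.aestronglyMeasurable
  rw [e0] at h
  refine h.congr fun j => ?_
  rw [hE j _ g.continuous, Fintype.expect_eq_sum_div_card]
  simp [div_eq_inv_mul]

lemma expect_signSum_sq {V : Type*} [Fintype V] [DecidableEq V] (w : V → ℝ) (S : Finset V) :
    𝔼 ε, signSum w S ε ^ 2 = ∑ a ∈ S, w a ^ 2 := by
  induction S using Finset.induction_on with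
  | empty => simp [signSum]
  | insert a S ha ih =>
    have h1 : ∀ ε, signSum w (insert a S) ε = signSum w S ε + sgn (ε a) * w a := fun ε => by
      rw [signSum, Finset.sum_insert ha, signSum, smul_eq_mul, add_comm]
    have h2 : 𝔼 ε, signSum w (insert a S) ε ^ 2
        = 𝔼 ε, signSum w (insert a S) (flipAt a ε) ^ 2 :=
      (expect_flipAt a fun ε => signSum w (insert a S) ε ^ 2).symm
    have h3 : 𝔼 ε, signSum w (insert a S) ε ^ 2 + 𝔼 ε, signSum w (insert a S) (flipAt a ε) ^ 2
        = 𝔼 ε, (2 * signSum w S ε ^ 2 + 2 * w a ^ 2) := by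
      rw [← Finset.expect_add_distrib]
      refine Finset.expect_congr rfl fun ε _ => ?_
      rw [h1, h1, signSum_flipAt_of_notMem w ha]
      have : sgn (ε a) ^ 2 = 1 := by rw [← sq_abs, abs_sgn, one_pow]
      simp only [flipAt, Function.update_self, sgn_not]
      linear_combination 2 * w a ^ 2 * this
    rw [Finset.expect_add_distrib, ← Finset.mul_expect, ih,
      Finset.expect_const Finset.univ_nonempty] at h3
    rw [Finset.sum_insert ha]
    linarith

lemma expect_euclNorm_sq_stepVec_le {n q : ℕ} (S : Finset (Fin n × Fin q)) :
    𝔼 ε, euclNorm (signSum (stepVec n q) S ε) ^ 2 ≤ n := by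
  have h0 : ∀ x : Fin n → ℝ, euclNorm x ^ 2 = ∑ i, x i ^ 2 := fun x =>
    sq_sqrt (Finset.sum_nonneg fun i _ => sq_nonneg _)
  have h1 : ∀ i : Fin n, 𝔼 ε, signSum (stepVec n q) S ε i ^ 2 ≤ 1 := by
    intro i
    have e : ∀ ε, signSum (stepVec n q) S ε i
        = signSum (fun a : Fin n × Fin q => 1 / √q * if a.1 = i then (1 : ℝ) else 0) S ε :=
      fun ε => signSum_stepVec_apply S ε i
    simp_rw [e]
    rw [expect_signSum_sq]
    have h2 : ∑ a ∈ S, (1 / √(q : ℝ) * if a.1 = i then (1 : ℝ) else 0) ^ 2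
        = (fibre S i : ℝ) * (1 / q) := by
      rw [fibre, Finset.card_filter, Nat.cast_sum, Finset.sum_mul]
      refine Finset.sum_congr rfl fun a _ => ?_
      split_ifs <;> simp
    rw [h2, mul_one_div]
    exact div_le_one_of_le₀ (Nat.cast_le.2 (fibre_le S i)) (Nat.cast_nonneg _)
  simp_rw [h0]
  rw [Finset.expect_sum_comm]
  calc _ ≤ ∑ i : Fin n, (1 : ℝ) := Finset.sum_le_sum fun i _ => h1 i
    _ = n := by simp

lemma IsSemi.continuous_of_le_euclNorm {n : ℕ} {f : (Fin n → ℝ) → ℝ} (hf : IsSemi f)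
    (hle : ∀ x, f x ≤ euclNorm x) : Continuous f := by
  rw [continuous_iff_continuousAt]
  intro x
  rw [ContinuousAt, tendsto_iff_norm_sub_tendsto_zero]
  have h0 : Filter.Tendsto (fun y => euclNorm (y - x)) (𝓝 x) (𝓝 0) := by
    have h : Continuous fun y : Fin n → ℝ => euclNorm (y - x) :=
      continuous_euclNorm.comp (continuous_id.sub continuous_const)
    have := h.tendsto x
    simpa [euclNorm] using this
  exact squeeze_zero (fun _ => norm_nonneg _)
    (fun y => (hf.abs_sub_le y x).trans (hle _)) h0

lemma integrable_of_integral_min_le {α : Type*} [MeasurableSpace α] {μ : Measure α}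
    [IsFiniteMeasure μ] {g : α → ℝ} (hg : Measurable g) (hg0 : ∀ x, 0 ≤ g x) {a : ℝ}
    (h : ∀ R : ℕ, ∫ x, min (g x) R ∂μ ≤ a) : Integrable g μ ∧ ∫ x, g x ∂μ ≤ a := by
  have hm : ∀ R : ℕ, Measurable fun x => min (g x) (R : ℝ) := fun R => hg.min measurable_const
  have hm0 : ∀ (R : ℕ) x, 0 ≤ min (g x) (R : ℝ) := fun R x => le_min (hg0 x) (Nat.cast_nonneg _)
  have hi : ∀ R : ℕ, Integrable (fun x => min (g x) (R : ℝ)) μ := fun R =>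
    Integrable.of_bound (hm R).aestronglyMeasurable R (ae_of_all _ fun x => by
      rw [norm_eq_abs, abs_of_nonneg (hm0 R x)]; exact min_le_right _ _)
  have ha : 0 ≤ a := (integral_nonneg (hm0 0)).trans (h 0)
  have hl : ∫⁻ x, ENNReal.ofReal (g x) ∂μ ≤ ENNReal.ofReal a := by
    have ht := lintegral_tendsto_of_tendsto_of_monotone (μ := μ)
      (f := fun (R : ℕ) x => ENNReal.ofReal (min (g x) R)) (F := fun x => ENNReal.ofReal (g x))
      (fun R => (hm R).ennreal_ofReal.aemeasurable)
      (ae_of_all _ fun x R R' hR => ENNReal.ofReal_le_ofReal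
        (min_le_min_left _ (Nat.cast_le.2 hR)))
      (ae_of_all _ fun x => by
        obtain ⟨R, hR⟩ := exists_nat_ge (g x)
        refine tendsto_const_nhds.congr' ?_
        filter_upwards [Filter.eventually_ge_atTop R] with k hk
        rw [min_eq_left (hR.trans (Nat.cast_le.2 hk))])
    refine le_of_tendsto' ht fun R => ?_
    rw [← ofReal_integral_eq_lintegral_ofReal (hi R) (ae_of_all _ (hm0 R))]
    exact ENNReal.ofReal_le_ofReal (h R)
  have hint : Integrable g μ := ⟨hg.aestronglyMeasurable, by
    rw [hasFiniteIntegral_iff_ofReal (ae_of_all _ hg0)]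
    exact hl.trans_lt ENNReal.ofReal_lt_top⟩
  refine ⟨hint, ?_⟩
  rw [← ofReal_integral_eq_lintegral_ofReal hint (ae_of_all _ hg0)] at hl
  exact (ENNReal.ofReal_le_ofReal_iff ha).1 hl

lemma tendsto_expect_min {n : ℕ} {q : ℕ → ℕ}
    (hq : Filter.Tendsto q Filter.atTop Filter.atTop)
    (S : ∀ j, Finset (Fin n × Fin (q j))) (l : Fin n → ℝ)
    (hS : ∀ i, Filter.Tendsto (fun j => (fibre (S j) i : ℝ) / q j) Filter.atTop (𝓝 (l i ^ 2)))
    {g : (Fin n → ℝ) → ℝ} (hg : Continuous g) (hg0 : ∀ x, 0 ≤ g x) (R : ℕ) :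
    Filter.Tendsto (fun j => 𝔼 ε, min (g (signSum (stepVec n (q j)) (S j) ε)) R) Filter.atTop
      (𝓝 (∫ z, min (g (l * z)) R ∂stdGaussian n)) := by
  have hb : ∀ x : EuclideanSpace ℝ (Fin n), ‖min (g x.ofLp) (R : ℝ)‖ ≤ R := fun x => by
    rw [norm_eq_abs, abs_of_nonneg (le_min (hg0 _) (Nat.cast_nonneg _))]
    exact min_le_right _ _
  have hc : Continuous fun x : EuclideanSpace ℝ (Fin n) => min (g x.ofLp) (R : ℝ) :=
    (hg.comp (PiLp.continuous_ofLp 2 _)).min continuous_const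
  exact tendsto_expect_signSum hq S l hS (BoundedContinuousFunction.ofNormedAddCommGroup _ hc R hb)

lemma integral_le_of_expect_le {n : ℕ} {q : ℕ → ℕ}
    (hq : Filter.Tendsto q Filter.atTop Filter.atTop)
    (S : ∀ j, Finset (Fin n × Fin (q j))) (l : Fin n → ℝ)
    (hS : ∀ i, Filter.Tendsto (fun j => (fibre (S j) i : ℝ) / q j) Filter.atTop (𝓝 (l i ^ 2)))
    {g : (Fin n → ℝ) → ℝ} (hg : Continuous g) (hg0 : ∀ x, 0 ≤ g x)
    {u : ℕ → ℝ} {a : ℝ} (hu : Filter.Tendsto u Filter.atTop (𝓝 a))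
    (h : ∀ᶠ j in Filter.atTop, 𝔼 ε, g (signSum (stepVec n (q j)) (S j) ε) ≤ u j) :
    Integrable (fun z => g (l * z)) (stdGaussian n) ∧ ∫ z, g (l * z) ∂stdGaussian n ≤ a := by
  refine integrable_of_integral_min_le (hg.comp (by fun_prop)).measurable (fun _ => hg0 _)
    fun R => ?_
  refine le_of_tendsto_of_tendsto (tendsto_expect_min hq S l hS hg hg0 R) hu ?_
  filter_upwards [h] with j hj
  exact (expect_mono fun ε => min_le_left _ _).trans hj

lemma tendsto_expect_semi {n : ℕ} {q : ℕ → ℕ}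
    (hq : Filter.Tendsto q Filter.atTop Filter.atTop)
    (S : ∀ j, Finset (Fin n × Fin (q j))) (l : Fin n → ℝ)
    (hS : ∀ i, Filter.Tendsto (fun j => (fibre (S j) i : ℝ) / q j) Filter.atTop (𝓝 (l i ^ 2)))
    {f : (Fin n → ℝ) → ℝ} (hf : IsSemi f) (hle : ∀ x, f x ≤ euclNorm x) :
    Integrable (fun z => f (l * z)) (stdGaussian n) ∧
    Filter.Tendsto (fun j => 𝔼 ε, f (signSum (stepVec n (q j)) (S j) ε)) Filter.atTop
      (𝓝 (∫ z, f (l * z) ∂stdGaussian n)) := by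
  have hc := hf.continuous_of_le_euclNorm hle
  have hcl : Continuous fun z => f (l * z) := hc.comp (by fun_prop)
  have h2 : ∀ j, 𝔼 ε, f (signSum (stepVec n (q j)) (S j) ε) ^ 2 ≤ n := fun j =>
    (expect_mono fun ε => pow_le_pow_left₀ (hf.nonneg _) (hle _) 2).trans
      (expect_euclNorm_sq_stepVec_le _)
  obtain ⟨hi2, hn2⟩ := integral_le_of_expect_le hq S l hS (g := fun x => f x ^ 2)
    (hc.pow 2) (fun x => sq_nonneg (f x))
    tendsto_const_nhds (Filter.Eventually.of_forall h2)
  have hi : Integrable (fun z => f (l * z)) (stdGaussian n) := by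
    refine (hi2.add (integrable_const 1)).mono' hcl.aestronglyMeasurable (ae_of_all _ fun z => ?_)
    rw [norm_eq_abs, abs_of_nonneg (hf.nonneg _)]
    simp only [Pi.add_apply]
    nlinarith [sq_nonneg (f (l * z) - 1 / 2)]
  refine ⟨hi, ?_⟩
  have htr : ∀ {x R : ℝ}, 0 ≤ x → 0 < R → x - min x R ≤ x ^ 2 / R := by
    intro x R hx hR
    rcases le_total x R with h | h
    · rw [min_eq_left h, sub_self]; positivity
    · rw [min_eq_right h, le_div_iff₀ hR]; nlinarith
  rw [Metric.tendsto_atTop]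
  intro δ hδ
  obtain ⟨R, hR⟩ := exists_nat_gt ((n : ℝ) / (δ / 3))
  have hR0 : (0 : ℝ) < R := lt_of_le_of_lt (by positivity) hR
  have hRn : (n : ℝ) / R < δ / 3 := by
    rw [div_lt_iff₀ (by positivity)] at hR
    rw [div_lt_iff₀ hR0]
    linarith
  obtain ⟨J, hJ⟩ := Metric.tendsto_atTop.1 (tendsto_expect_min hq S l hS hc hf.nonneg R) (δ / 3)
    (by positivity)
  have him : Integrable (fun z => min (f (l * z)) (R : ℝ)) (stdGaussian n) := hi.inf
    (integrable_const _)
  refine ⟨J, fun j hj => ?_⟩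
  have h3 := hJ j hj
  rw [Real.dist_eq, abs_lt] at h3 ⊢
  have a1 : 𝔼 ε, f (signSum (stepVec n (q j)) (S j) ε)
      ≤ 𝔼 ε, min (f (signSum (stepVec n (q j)) (S j) ε)) R + n / R := by
    calc _ ≤ 𝔼 ε, (min (f (signSum (stepVec n (q j)) (S j) ε)) R
          + f (signSum (stepVec n (q j)) (S j) ε) ^ 2 * (1 / R)) := expect_mono fun ε => by
            have := htr (hf.nonneg (signSum (stepVec n (q j)) (S j) ε)) hR0
            rw [mul_one_div]; linarith
      _ ≤ _ := by
          rw [Finset.expect_add_distrib, ← Finset.expect_mul, ← mul_one_div (n : ℝ)]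
          gcongr
          exact h2 j
  have a2 : 𝔼 ε, min (f (signSum (stepVec n (q j)) (S j) ε)) R
      ≤ 𝔼 ε, f (signSum (stepVec n (q j)) (S j) ε) := expect_mono fun ε => min_le_left _ _
  have b1 : ∫ z, f (l * z) ∂stdGaussian n
      ≤ ∫ z, min (f (l * z)) R ∂stdGaussian n + n / R := by
    have h4 : ∫ z, f (l * z) ∂stdGaussian n
        ≤ ∫ z, (min (f (l * z)) R + f (l * z) ^ 2 * (1 / R)) ∂stdGaussian n := by
      refine integral_mono hi (him.add (hi2.mul_const _)) fun z => ?_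
      have := htr (hf.nonneg (l * z)) hR0
      simp only [mul_one_div]
      linarith
    rw [integral_add him (hi2.mul_const _), integral_mul_const] at h4
    refine h4.trans ?_
    rw [← mul_one_div (n : ℝ)]
    gcongr
  have b2 : ∫ z, min (f (l * z)) R ∂stdGaussian n ≤ ∫ z, f (l * z) ∂stdGaussian n :=
    integral_mono him hi fun z => min_le_left _ _
  constructor <;> linarith

/-- An exponential moment bound for the random walks gives a Gaussian tail bound. -/
lemma tail_of_expect_exp_le {n : ℕ} {q : ℕ → ℕ}
    (hq : Filter.Tendsto q Filter.atTop Filter.atTop)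
    (S : ∀ j, Finset (Fin n × Fin (q j))) (l : Fin n → ℝ)
    (hS : ∀ i, Filter.Tendsto (fun j => (fibre (S j) i : ℝ) / q j) Filter.atTop (𝓝 (l i ^ 2)))
    {f : (Fin n → ℝ) → ℝ} (hf : IsSemi f)
    (hle : ∀ x, f x ≤ euclNorm x) {θ A : ℝ} (hθ : 0 ≤ θ)
    (h : ∀ τ, |τ| = θ → ∀ᶠ j in Filter.atTop,
      𝔼 ε, exp (τ * (f (signSum (stepVec n (q j)) (S j) ε)
        - 𝔼 ε', f (signSum (stepVec n (q j)) (S j) ε'))) ≤ A) (s : ℝ) :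
    stdGaussian n {z | s < |f (l * z) - ∫ y, f (l * y) ∂stdGaussian n|}
      ≤ ENNReal.ofReal (2 * A * exp (-(θ * s))) := by
  have hc := hf.continuous_of_le_euclNorm hle
  have ht := (tendsto_expect_semi hq S l hS hf hle).2
  set m := ∫ y, f (l * y) ∂stdGaussian n with hm
  have key : ∀ τ, |τ| = θ → Integrable (fun z => exp (τ * (f (l * z) - m))) (stdGaussian n) ∧
      ∫ z, exp (τ * (f (l * z) - m)) ∂stdGaussian n ≤ A := by
    intro τ hτ
    have hu : Filter.Tendsto (fun j => A * exp (τ * (𝔼 ε', f (signSum (stepVec n (q j)) (S j) ε')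
        - m))) Filter.atTop (𝓝 (A * exp (τ * (m - m)))) :=
      ((continuous_exp.tendsto _).comp ((ht.sub_const m).const_mul τ)).const_mul A
    rw [sub_self, mul_zero, exp_zero, mul_one] at hu
    refine integral_le_of_expect_le hq S l hS (g := fun x => exp (τ * (f x - m))) (by fun_prop)
      (fun _ => (exp_pos _).le) hu ?_
    filter_upwards [h τ hτ] with j hj
    calc _ = 𝔼 ε, exp (τ * (f (signSum (stepVec n (q j)) (S j) ε)
          - 𝔼 ε', f (signSum (stepVec n (q j)) (S j) ε')))
          * exp (τ * (𝔼 ε', f (signSum (stepVec n (q j)) (S j) ε') - m)) :=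
        Finset.expect_congr rfl fun ε _ => by rw [← exp_add]; congr 1; ring
      _ ≤ _ := by
        rw [← Finset.expect_mul]
        exact mul_le_mul_of_nonneg_right hj (exp_pos _).le
  obtain ⟨i1, k1⟩ := key θ (abs_of_nonneg hθ)
  obtain ⟨i2, k2⟩ := key (-θ) (by rw [abs_neg, abs_of_nonneg hθ])
  have hsub : {z | s < |f (l * z) - m|} ⊆ {z | exp (θ * s) ≤ exp (θ * (f (l * z) - m))
      + exp (-θ * (f (l * z) - m))} := by
    intro z (hz : s < |f (l * z) - m|)
    show exp (θ * s) ≤ _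
    rcases abs_cases (f (l * z) - m) with ⟨h1, _⟩ | ⟨h1, _⟩ <;> rw [h1] at hz
    · exact (exp_le_exp.2 (mul_le_mul_of_nonneg_left hz.le hθ)).trans
        (le_add_of_nonneg_right (exp_pos _).le)
    · refine le_trans (exp_le_exp.2 ?_) (le_add_of_nonneg_left (exp_pos _).le)
      nlinarith
  refine (measure_mono hsub).trans ?_
  have hmk := mul_meas_ge_le_integral_of_nonneg (μ := stdGaussian n)
    (ae_of_all _ fun z => add_nonneg (exp_pos (θ * (f (l * z) - m))).le
      (exp_pos (-θ * (f (l * z) - m))).le) (i1.add i2) (exp (θ * s))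
  rw [← ofReal_measureReal]
  refine ENNReal.ofReal_le_ofReal ?_
  rw [integral_add i1 i2] at hmk
  rw [exp_neg, ← div_eq_mul_inv, le_div_iff₀ (exp_pos _), mul_comm]
  exact hmk.trans (by linarith)

lemma half_le_integral_abs_gaussianReal : 1 / 2 ≤ ∫ x, |x| ∂gaussianReal 0 1 := by
  have h1 : ∫ x in Set.Ioi (0 : ℝ), x ^ (1 : ℝ) * exp (-(1 / 2) * x ^ (2 : ℝ)) = 1 := by
    rw [integral_rpow_mul_exp_neg_mul_rpow (by norm_num) (by norm_num) (by norm_num)]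
    norm_num
  have h2 : ∫ x, |x| ∂gaussianReal 0 1
      = ∫ x : ℝ, (fun y => (√(2 * π))⁻¹ * (y ^ (1 : ℝ) * exp (-(1 / 2) * y ^ (2 : ℝ)))) |x| := by
    rw [integral_gaussianReal_eq_integral_smul one_ne_zero]
    refine integral_congr_ae (ae_of_all _ fun x => ?_)
    simp only [gaussianPDFReal, smul_eq_mul, rpow_one, rpow_two, sq_abs]
    simp
    ring_nf
  have h3 : √(2 * π) ≤ 4 := by
    rw [sqrt_le_left (by norm_num)]
    nlinarith [pi_le_four]
  have h4 : 0 < √(2 * π) := sqrt_pos.2 (by positivity)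
  rw [h2, integral_comp_abs (f := fun y => (√(2 * π))⁻¹ *
    (y ^ (1 : ℝ) * exp (-(1 / 2) * y ^ (2 : ℝ)))), integral_const_mul, h1, mul_one,
    ← div_eq_mul_inv, div_le_div_iff₀ (by norm_num) h4]
  linarith

lemma measurePreserving_sgn_mul {n : ℕ} (ε : Fin n → Bool) :
    MeasurePreserving (fun (z : Fin n → ℝ) i => sgn (ε i) * z i) (stdGaussian n)
      (stdGaussian n) := by
  refine measurePreserving_pi _ _ fun i => ?_
  cases ε i
  · refine ⟨by fun_prop, ?_⟩
    have e : HMul.hMul (sgn false) = fun x : ℝ => -x := by ext x; simp [sgn]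
    rw [e, gaussianReal_map_neg, neg_zero]
  · have e : HMul.hMul (sgn true) = (id : ℝ → ℝ) := by ext x; simp [sgn]
    rw [e]
    exact MeasurePreserving.id _

lemma signSum_single {n : ℕ} (x : Fin n → ℝ) (ε : Fin n → Bool) :
    signSum (fun i => x i • (Pi.single i 1 : Fin n → ℝ)) Finset.univ ε
      = fun i => sgn (ε i) * x i := by
  ext j
  simp [signSum, Finset.sum_apply, Pi.single_apply]

lemma integral_eq_integral_expect {n : ℕ} {f : (Fin n → ℝ) → ℝ} (hf : Continuous f)
    (l : Fin n → ℝ) (hi : Integrable (fun z => f (l * z)) (stdGaussian n)) :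
    Integrable (fun z : Fin n → ℝ => 𝔼 ε : Fin n → Bool, f (fun i => sgn (ε i) * (l i * z i)))
      (stdGaussian n) ∧
    ∫ z, f (l * z) ∂stdGaussian n
      = ∫ z : Fin n → ℝ, 𝔼 ε : Fin n → Bool, f (fun i => sgn (ε i) * (l i * z i))
          ∂stdGaussian n := by
  have e : ∀ (ε : Fin n → Bool) (z : Fin n → ℝ), f (fun i => sgn (ε i) * (l i * z i))
      = f (l * fun i => sgn (ε i) * z i) := fun ε z => by
    congr 1
    ext i
    simp only [Pi.mul_apply]
    ring
  have hi2 : ∀ ε : Fin n → Bool, Integrable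
      (fun z : Fin n → ℝ => f (l * fun i => sgn (ε i) * z i)) (stdGaussian n) := fun ε =>
    (measurePreserving_sgn_mul ε).integrable_comp_of_integrable hi
  have e2 : ∀ ε : Fin n → Bool, ∫ z : Fin n → ℝ, f (l * fun i => sgn (ε i) * z i) ∂stdGaussian n
      = ∫ z, f (l * z) ∂stdGaussian n := fun ε => by
    rw [← integral_map (φ := fun (z : Fin n → ℝ) i => sgn (ε i) * z i)
      (f := fun z => f (l * z)) (measurePreserving_sgn_mul ε).measurable.aemeasurable
      (hf.comp (by fun_prop)).aestronglyMeasurable, (measurePreserving_sgn_mul ε).map_eq]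
  simp_rw [e, Fintype.expect_eq_sum_div_card]
  refine ⟨(integrable_finsetSum _ fun ε _ => hi2 ε).div_const _, ?_⟩
  rw [integral_div, integral_finsetSum _ fun ε _ => hi2 ε]
  simp [e2]

/-- Gaussian averages dominate Rademacher averages. -/
lemma expect_signSum_le_integral {n : ℕ} {f : (Fin n → ℝ) → ℝ} (hf : IsSemi f)
    (hc : Continuous f) (hi : Integrable f (stdGaussian n)) :
    𝔼 ε, f (signSum (fun i => (Pi.single i 1 : Fin n → ℝ)) Finset.univ ε)
      ≤ 2 * ∫ z, f z ∂stdGaussian n := by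
  let φ : (Fin n → ℝ) → ℝ := fun x => 𝔼 ε : Fin n → Bool, f (fun i => sgn (ε i) * x i)
  have hφ : IsSemi φ := by
    constructor
    · intro x y
      simp only [φ]
      rw [← Finset.expect_add_distrib]
      refine expect_mono fun ε => ?_
      refine le_trans (le_of_eq ?_) (hf.add_le _ _)
      congr 1
      ext i
      simp only [Pi.add_apply]
      ring
    · intro r x
      simp only [φ]
      rw [Finset.mul_expect]
      refine Finset.expect_congr rfl fun ε _ => ?_
      rw [← hf.smul]
      congr 1
      ext i
      simp only [Pi.smul_apply, smul_eq_mul]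
      ring
  have habs : ∀ z : Fin n → ℝ, φ (fun i => |z i|) = φ z := by
    intro z
    refine Fintype.expect_equiv (Equiv.piCongrRight fun i =>
      if 0 ≤ z i then Equiv.refl Bool else Equiv.boolNot) _ _ fun ε => ?_
    congr 1
    ext i
    by_cases h : 0 ≤ z i
    · simp [h, abs_of_nonneg h]
    · simp [h, abs_of_neg (not_le.1 h), sgn_not]
  obtain ⟨y, hy1, hy2⟩ := hφ.exists_subgradient (fun _ => 1)
  obtain ⟨hiφ, heφ⟩ := integral_eq_integral_expect hc (fun _ => 1) (by
    refine hi.congr (ae_of_all _ fun z => ?_)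
    congr 1
    ext i
    simp)
  have hone : ∀ z : Fin n → ℝ, (fun _ => (1 : ℝ)) * z = z := fun z => by ext i; simp
  simp only [one_mul, hone] at hiφ heφ
  have hsum : ∀ x : Fin n → ℝ, y x = ∑ i, x i * y (Pi.single i 1) := fun x => by
    conv_lhs => rw [pi_eq_sum_univ x, map_sum]
    refine Finset.sum_congr rfl fun i _ => ?_
    rw [map_smul, smul_eq_mul]
    congr 2
    ext j
    simp [Pi.single_apply, eq_comm]
  have hia : ∀ i : Fin n, Integrable (fun z : Fin n → ℝ => |z i|) (stdGaussian n) := fun i =>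
    (measurePreserving_eval (fun _ : Fin n => gaussianReal 0 1) i).integrable_comp_of_integrable
      (g := fun x => |x|) ((memLp_id_gaussianReal 1).integrable le_rfl).abs
  have hea : ∀ i : Fin n, ∫ z : Fin n → ℝ, |z i| ∂stdGaussian n = ∫ x, |x| ∂gaussianReal 0 1 := by
    intro i
    rw [← (measurePreserving_eval (fun _ : Fin n => gaussianReal 0 1) i).map_eq,
      integral_map (measurable_pi_apply i).aemeasurable (by fun_prop)]
    rfl
  have hJ : ∫ z : Fin n → ℝ, y (fun i => |z i|) ∂stdGaussian n
      = (∫ x, |x| ∂gaussianReal 0 1) * φ (fun _ => 1) := by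
    simp_rw [hsum fun i => |_|]
    rw [integral_finsetSum _ fun i _ => (hia i).mul_const _]
    simp_rw [integral_mul_const, hea]
    rw [← Finset.mul_sum, ← hy1, hsum]
    simp
  have hle : ∫ z : Fin n → ℝ, y (fun i => |z i|) ∂stdGaussian n ≤ ∫ z, φ z ∂stdGaussian n := by
    refine integral_mono ?_ hiφ fun z => ?_
    · simp_rw [hsum fun i => |_|]
      exact integrable_finsetSum _ fun i _ => (hia i).mul_const _
    · rw [← habs z]
      exact (le_abs_self _).trans (hy2 _)
  have e1 : 𝔼 ε, f (signSum (fun i => (Pi.single i 1 : Fin n → ℝ)) Finset.univ ε)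
      = φ (fun _ => 1) := by
    refine Finset.expect_congr rfl fun ε _ => ?_
    have := signSum_single (fun _ => 1) ε
    simp only [one_smul] at this
    rw [this]
  rw [e1, heφ]
  have h0 := hφ.nonneg (fun _ => (1 : ℝ))
  nlinarith [half_le_integral_abs_gaussianReal]

lemma gaussianReal_tail_ge {R : ℝ} (hR : 0 ≤ R) :
    1 / 4 * exp (-(R + 1) ^ 2 / 2) ≤ 1 - (gaussianReal 0 1).real (Set.Icc (-R) R) := by
  have h1 : (gaussianReal 0 1).real (Set.Ioc R (R + 1))
      ≤ 1 - (gaussianReal 0 1).real (Set.Icc (-R) R) := by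
    rw [← probReal_compl_eq_one_sub measurableSet_Icc]
    exact measureReal_mono fun x hx h => absurd hx.1 (not_lt.2 h.2)
  refine le_trans ?_ h1
  rw [Measure.real, gaussianReal_apply_eq_integral _ one_ne_zero, ENNReal.toReal_ofReal
    (integral_nonneg fun x => gaussianPDFReal_nonneg _ _ _)]
  have h2 : ∫ x in Set.Ioc R (R + 1), 1 / 4 * exp (-(R + 1) ^ 2 / 2)
      ≤ ∫ x in Set.Ioc R (R + 1), gaussianPDFReal 0 1 x := by
    refine setIntegral_mono_on (integrableOn_const (by simp))
      (integrable_gaussianPDFReal 0 1).integrableOn measurableSet_Ioc fun x hx => ?_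
    have h3 : √(2 * π) ≤ 4 := by
      rw [sqrt_le_left (by norm_num)]
      nlinarith [pi_le_four]
    have h4 : 0 < √(2 * π) := sqrt_pos.2 (by positivity)
    simp only [gaussianPDFReal, NNReal.coe_one, mul_one, sub_zero]
    refine mul_le_mul ?_ (exp_le_exp.2 ?_) (exp_pos _).le (by positivity)
    · rw [← one_div]
      exact one_div_le_one_div_of_le h4 h3
    · have : x ^ 2 ≤ (R + 1) ^ 2 := pow_le_pow_left₀ (hR.trans hx.1.le) hx.2 2
      linarith
  simpa using h2

lemma le_integral_of_good_coords {n : ℕ} {f : (Fin n → ℝ) → ℝ} (hf : IsSemi f)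
    (hc : Continuous f) (l : Fin n → ℝ) (hi : Integrable (fun z => f (l * z)) (stdGaussian n))
    (G : Finset (Fin n)) {a R : ℝ} (ha : 0 ≤ a)
    (hG : ∀ i ∈ G, a ≤ |l i| * f (Pi.single i 1)) (hR : 0 ≤ R)
    (hcard : 1 ≤ G.card * (1 / 4 * exp (-(R + 1) ^ 2 / 2))) :
    a * R / 2 ≤ ∫ z, f (l * z) ∂stdGaussian n := by
  obtain ⟨hiφ, heφ⟩ := integral_eq_integral_expect hc l hi
  let A : Set (Fin n → ℝ) := Set.univ.pi fun i => if i ∈ G then Set.Icc (-R) R else Set.univ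
  have hA : MeasurableSet A := MeasurableSet.univ_pi fun i => by
    split_ifs
    · exact measurableSet_Icc
    · exact MeasurableSet.univ
  have hpt : ∀ z : Fin n → ℝ, Aᶜ.indicator (fun _ => a * R) z
      ≤ 𝔼 ε : Fin n → Bool, f (fun i => sgn (ε i) * (l i * z i)) := by
    intro z
    by_cases hz : z ∈ A
    · rw [Set.indicator_of_notMem (by simpa using hz)]
      exact expect_nonneg' fun ε => hf.nonneg _
    · rw [Set.indicator_of_mem hz]
      simp only [A, Set.mem_univ_pi, not_forall] at hz
      obtain ⟨i, hzi⟩ := hz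
      have hiG : i ∈ G := by
        by_contra h
        simp [h] at hzi
      rw [if_pos hiG, Set.mem_Icc, ← abs_le, not_le] at hzi
      have h1 := expect_signSum_mono (fun i => (l i * z i) • (Pi.single i 1 : Fin n → ℝ)) hf
        (Finset.subset_univ {i})
      simp_rw [signSum_single (fun i => l i * z i)] at h1
      refine le_trans ?_ h1
      have h2 : ∀ ε : Fin n → Bool, f (signSum (fun i => (l i * z i) •
          (Pi.single i 1 : Fin n → ℝ)) {i} ε) = |z i| * (|l i| * f (Pi.single i 1)) := fun ε => by
        rw [signSum, Finset.sum_singleton, hf.smul, hf.smul, abs_sgn, abs_mul]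
        ring
      simp_rw [h2]
      rw [Finset.expect_const Finset.univ_nonempty, mul_comm a R]
      exact mul_le_mul hzi.le (hG i hiG) ha (abs_nonneg _)
  have hm : (stdGaussian n).real A
      = (gaussianReal 0 1).real (Set.Icc (-R) R) ^ G.card := by
    have : stdGaussian n A = ∏ i, if i ∈ G then gaussianReal 0 1 (Set.Icc (-R) R) else 1 := by
      rw [_root_.stdGaussian, Measure.pi_pi]
      refine Finset.prod_congr rfl fun i _ => ?_
      split_ifs <;> simp
    rw [Measure.real, this, Finset.prod_ite_mem, Finset.univ_inter, Finset.prod_const,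
      ENNReal.toReal_pow, Measure.real]
  set p := 1 / 4 * exp (-(R + 1) ^ 2 / 2) with hp
  have hm2 : (stdGaussian n).real A ≤ 1 / 2 := by
    have h3 := gaussianReal_tail_ge hR
    rw [hm]
    have h4 : (gaussianReal 0 1).real (Set.Icc (-R) R) ≤ exp (-p) := by
      have := add_one_le_exp (-p)
      linarith
    calc _ ≤ exp (-p) ^ G.card := pow_le_pow_left₀ measureReal_nonneg h4 _
      _ = exp (-(G.card * p)) := by rw [← exp_nat_mul]; congr 1; ring
      _ ≤ exp (-1) := exp_le_exp.2 (by linarith)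
      _ ≤ 1 / 2 := by
        rw [exp_neg, ← one_div]
        exact one_div_le_one_div_of_le (by norm_num) (by linarith [add_one_le_exp (1 : ℝ)])
  rw [heφ]
  refine le_trans ?_ (integral_mono ((integrable_const _).indicator hA.compl) hiφ hpt)
  rw [integral_indicator hA.compl, setIntegral_const, probReal_compl_eq_one_sub hA, smul_eq_mul]
  have : 0 ≤ a * R := by positivity
  nlinarith

lemma measurePreserving_comp_injective {m n : ℕ} {e : Fin m → Fin n}
    (he : Function.Injective e) :
    MeasurePreserving (fun (z : Fin n → ℝ) k => z (e k)) (stdGaussian n) (stdGaussian m) := by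
  have hmeas : Measurable fun (z : Fin n → ℝ) k => z (e k) := by fun_prop
  refine ⟨hmeas, Eq.symm ?_⟩
  refine Measure.pi_eq fun s hs => ?_
  rw [Measure.map_apply hmeas (MeasurableSet.univ_pi hs)]
  have h1 : (fun (z : Fin n → ℝ) k => z (e k)) ⁻¹' Set.univ.pi s
      = Set.univ.pi (Function.extend e s fun _ => Set.univ) := by
    ext z
    simp only [Set.mem_preimage, Set.mem_univ_pi]
    constructor
    · intro h i
      by_cases hi : ∃ k, e k = i
      · obtain ⟨k, rfl⟩ := hi
        rw [he.extend_apply]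
        exact h k
      · rw [Function.extend_apply' _ _ _ hi]
        trivial
    · intro h k
      have := h (e k)
      rwa [he.extend_apply] at this
  rw [h1, _root_.stdGaussian, Measure.pi_pi]
  refine (Fintype.prod_of_injective e he _ _ (fun i hi => ?_) fun k => ?_).symm
  · rw [Function.extend_apply' _ _ _ hi, measure_univ]
  · rw [he.extend_apply]

lemma euclNorm_single {n : ℕ} (i : Fin n) : euclNorm (Pi.single i 1 : Fin n → ℝ) = 1 := by
  simp [euclNorm, Pi.single_apply]

lemma semi_stepVec_le {n q : ℕ} {f : (Fin n → ℝ) → ℝ} (hf : IsSemi f)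
    (hle : ∀ x, f x ≤ euclNorm x) (a : Fin n × Fin q) : f (stepVec n q a) ≤ 1 / √q := by
  rw [stepVec, hf.smul, abs_of_nonneg (by positivity)]
  exact mul_le_of_le_one_right (by positivity) ((hle _).trans (euclNorm_single _).le)

lemma semi_sum_stepVec_le {n q : ℕ} {f : (Fin n → ℝ) → ℝ} (hle : ∀ x, f x ≤ euclNorm x)
    (c : Fin n × Fin q → ℝ) : f (∑ a, c a • stepVec n q a) ≤ √(∑ a, c a ^ 2) := by
  refine (hle _).trans (sqrt_le_sqrt ?_)
  have h1 : ∀ i, (∑ a, c a • stepVec n q a) i = 1 / √q * ∑ k, c (i, k) := by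
    intro i
    simp only [stepVec, Finset.sum_apply, Pi.smul_apply, Pi.single_apply, smul_eq_mul,
      Fintype.sum_prod_type, Finset.mul_sum]
    rw [Finset.sum_eq_single i]
    · exact Finset.sum_congr rfl fun k _ => by simp; ring
    · intro b _ hb
      simp [hb.symm]
    · simp
  rw [Fintype.sum_prod_type fun a : Fin n × Fin q => c a ^ 2]
  refine Finset.sum_le_sum fun i _ => ?_
  rw [h1, mul_pow, div_pow, one_pow, sq_sqrt (Nat.cast_nonneg _)]
  have h2 := sq_sum_le_card_mul_sum_sq (s := Finset.univ) (f := fun k : Fin q => c (i, k))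
  rw [Finset.card_univ, Fintype.card_fin] at h2
  rcases Nat.eq_zero_or_pos q with h0 | h0
  · subst h0; simp
  · rw [one_div, inv_mul_le_iff₀ (Nat.cast_pos.2 h0)]
    exact h2

lemma semi_sum_stepVec_le_of_bounded {n q : ℕ} {f : (Fin n → ℝ) → ℝ} (hf : IsSemi f)
    (σ : Finset (Fin n)) {K : ℝ}
    (hK : ∀ c : Fin n → ℝ, (∀ i, |c i| ≤ 1) → f (∑ i ∈ σ, c i • (Pi.single i 1 : Fin n → ℝ)) ≤ K)
    {S : Finset (Fin n × Fin q)} (hS : S ⊆ σ ×ˢ Finset.univ) (c : Fin n × Fin q → ℝ)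
    (hc : ∀ a, |c a| ≤ 1) : f (∑ a ∈ S, c a • stepVec n q a) ≤ K * √q := by
  rcases Nat.eq_zero_or_pos q with h0 | h0
  · subst h0
    have : S = ∅ := Finset.eq_empty_of_isEmpty S
    simp [this, hf.zero]
  have hq : (0 : ℝ) < q := Nat.cast_pos.2 h0
  let d : Fin n → ℝ := fun i => 1 / q * ∑ k, if (i, k) ∈ S then c (i, k) else 0
  have hd : ∀ i, |d i| ≤ 1 := by
    intro i
    rw [abs_mul, abs_of_nonneg (by positivity), one_div, inv_mul_le_iff₀ hq, mul_one]
    calc _ ≤ ∑ k : Fin q, |if (i, k) ∈ S then c (i, k) else 0| := Finset.abs_sum_le_sum_abs _ _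
      _ ≤ ∑ k : Fin q, (1 : ℝ) := Finset.sum_le_sum fun k _ => by
        split_ifs
        · exact hc _
        · simp
      _ = q := by simp
  have e : ∑ a ∈ S, c a • stepVec n q a
      = √q • ∑ i ∈ σ, d i • (Pi.single i 1 : Fin n → ℝ) := by
    have e1 : ∑ a ∈ S, c a • stepVec n q a
        = ∑ a ∈ σ ×ˢ Finset.univ, (if a ∈ S then c a else 0) • stepVec n q a := by
      rw [← Finset.sum_subset hS fun a _ ha => by simp [ha]]
      exact Finset.sum_congr rfl fun a ha => by simp [ha]
    rw [e1, Finset.sum_product, Finset.smul_sum]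
    refine Finset.sum_congr rfl fun i _ => ?_
    simp only [stepVec, d, smul_smul]
    rw [← Finset.sum_smul, ← Finset.sum_mul]
    congr 1
    have : √(q : ℝ) * (1 / q) = 1 / √q := by
      rw [mul_one_div, sqrt_div_self]
      simp
    rw [← mul_assoc, this, mul_comm]
  rw [e, hf.smul, abs_of_nonneg (sqrt_nonneg _), mul_comm]
  exact mul_le_mul_of_nonneg_right (hK d hd) (sqrt_nonneg _)

lemma eventually_mul_inv_sqrt_le {q : ℕ → ℕ} (hq : Filter.Tendsto q Filter.atTop Filter.atTop)
    (θ : ℝ) : ∀ᶠ j in Filter.atTop, |θ| * (1 / √(q j)) ≤ 1 / 2 := by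
  have h1 : Filter.Tendsto (fun j => √(q j : ℝ)) Filter.atTop Filter.atTop :=
    tendsto_sqrt_atTop.comp (tendsto_natCast_atTop_atTop.comp hq)
  have h2 : Filter.Tendsto (fun j => |θ| * (1 / √(q j : ℝ))) Filter.atTop (𝓝 0) := by
    simpa [div_eq_mul_inv] using (tendsto_const_nhds (x := |θ|)).div_atTop h1
  exact (h2.eventually_lt_const (by norm_num : (0 : ℝ) < 1 / 2)).mono fun _ h => h.le

/-- Gaussian concentration for Lipschitz seminorms. -/
lemma gaussian_concentration {n : ℕ} {q : ℕ → ℕ}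
    (hq : Filter.Tendsto q Filter.atTop Filter.atTop)
    (S : ∀ j, Finset (Fin n × Fin (q j))) (l : Fin n → ℝ)
    (hS : ∀ i, Filter.Tendsto (fun j => (fibre (S j) i : ℝ) / q j) Filter.atTop (𝓝 (l i ^ 2)))
    {f : (Fin n → ℝ) → ℝ} (hf : IsSemi f) (hle : ∀ x, f x ≤ euclNorm x) {s : ℝ} (hs : 0 ≤ s) :
    stdGaussian n {z | s < |f (l * z) - ∫ y, f (l * y) ∂stdGaussian n|}
      ≤ ENNReal.ofReal (2 * exp (-(s ^ 2 / 24))) := by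
  have h := tail_of_expect_exp_le hq S l hS hf hle (θ := s / 12) (A := exp (6 * (s / 12) ^ 2))
    (by positivity) (fun τ hτ => by
      filter_upwards [eventually_mul_inv_sqrt_le hq τ] with j hj
      have := mgf_cube_le (fun ε => f (signSum (stepVec n (q j)) (S j) ε)) (θ := τ)
        (dropAt_signSum_le _ hf (semi_stepVec_le hf hle) (by positivity) (S j)) (by positivity) hj
        (sum_dropAt_sq_le _ hf (semi_sum_stepVec_le hle) (S j))
      rwa [← hτ, sq_abs]) s
  refine h.trans (ENNReal.ofReal_le_ofReal (le_of_eq ?_))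
  rw [mul_assoc, ← exp_add]
  congr 2
  ring

lemma fibre_univ {n q : ℕ} (i : Fin n) : fibre (Finset.univ : Finset (Fin n × Fin q)) i = q := by
  have : (Finset.univ.filter fun a : Fin n × Fin q => a.1 = i)
      = Finset.univ.image fun k : Fin q => (i, k) := by
    ext ⟨b, k⟩
    simp [eq_comm]
  rw [fibre, this, Finset.card_image_of_injective _ (Prod.mk_right_injective i)]
  simp

lemma tendsto_fibre_univ {n : ℕ} {q : ℕ → ℕ} (hq : Filter.Tendsto q Filter.atTop Filter.atTop)
    (i : Fin n) :
    Filter.Tendsto (fun j => (fibre (Finset.univ : Finset (Fin n × Fin (q j))) i : ℝ) / q j)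
      Filter.atTop (𝓝 ((1 : Fin n → ℝ) i ^ 2)) := by
  simp only [Pi.one_apply, one_pow]
  refine tendsto_const_nhds.congr' ?_
  filter_upwards [hq.eventually_ge_atTop 1] with j hj
  rw [fibre_univ, div_self]
  exact Nat.cast_ne_zero.2 (by omega)

lemma exists_flat_subset {n : ℕ} (hn : 1 ≤ n) {f : (Fin n → ℝ) → ℝ} (hf : IsSemi f)
    (hle : ∀ x, f x ≤ euclNorm x) (hi : Integrable f (stdGaussian n)) {L : ℝ} (hL : 1 ≤ L)
    (hM : ∫ z, f z ∂stdGaussian n ≤ L) {s : Finset (Fin n)} (hs : n ≤ 2 * s.card) :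
    ∃ σ ⊆ s, √n / 4 ≤ (σ.card : ℝ) ∧ ∀ c : Fin n → ℝ, (∀ i, |c i| ≤ 1) →
      f (∑ i ∈ σ, c i • (Pi.single i 1 : Fin n → ℝ)) ≤ 5 * L := by
  have hn1 : (1 : ℝ) ≤ n := by exact_mod_cast hn
  have hsn : 1 ≤ √(n : ℝ) := one_le_sqrt.2 hn1
  obtain ⟨k, hk1, hk2⟩ := exists_nat_pow_near hsn (by norm_num : (1 : ℝ) < 2)
  have hr := (expect_signSum_le_integral hf (hf.continuous_of_le_euclNorm hle) hi).trans
    (mul_le_mul_of_nonneg_left hM zero_le_two)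
  have hK : ∀ c : Fin n → ℝ, (∀ i, |c i| ≤ 1) →
      f (∑ i ∈ s, c i • (Pi.single i 1 : Fin n → ℝ)) ≤ √n := by
    intro c hc
    refine (hle _).trans (sqrt_le_sqrt ?_)
    calc _ ≤ ∑ i : Fin n, (1 : ℝ) := Finset.sum_le_sum fun j _ => by
          rw [sq_le_one_iff_abs_le_one]
          simp only [Finset.sum_apply, Pi.smul_apply, Pi.single_apply, smul_eq_mul, mul_ite,
            mul_one, mul_zero, Finset.sum_ite_eq]
          split_ifs
          · exact hc j
          · simp
      _ = n := by simp
  obtain ⟨σ, h1, h2, h3⟩ := exists_linfty_subset hf _ s hr hK (k + 1)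
  refine ⟨σ, h1, ?_, fun c hc => (h3 c hc).trans ?_⟩
  · have h4 : (n : ℝ) ≤ 2 * (2 ^ (k + 1) * σ.card) := by
      have : n ≤ 2 * (2 ^ (k + 1) * σ.card) := by omega
      exact_mod_cast this
    have h5 : (2 : ℝ) ^ (k + 1) ≤ 2 * √n := by rw [pow_succ]; linarith
    have h6 : √(n : ℝ) * √n = n := mul_self_sqrt (by linarith)
    have h7 : √(n : ℝ) * √n ≤ √n * (4 * σ.card) := by
      rw [h6]
      refine h4.trans ?_
      have := mul_le_mul_of_nonneg_right h5 (Nat.cast_nonneg (α := ℝ) σ.card)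
      linarith
    have := le_of_mul_le_mul_left h7 (by linarith)
    linarith
  · have : √(n : ℝ) / 2 ^ (k + 1) ≤ 1 := by
      rw [div_le_one (by positivity)]
      exact hk2.le
    linarith

/-- Removing the influential steps from a random walk on `σ`. -/
lemma exists_trimmed {n q : ℕ} (hq : 4 ≤ q) {f : (Fin n → ℝ) → ℝ} (hf : IsSemi f)
    (hle : ∀ x, f x ≤ euclNorm x) {L : ℝ} (hL0 : 0 < L) (hL : 4 * exp 6 ≤ L ^ 2)
    (hM : 𝔼 ε, f (signSum (stepVec n q) Finset.univ ε) ≤ L) {σ : Finset (Fin n)}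
    (hσ : 0 < σ.card) :
    ∃ S ⊆ σ ×ˢ (Finset.univ : Finset (Fin q)),
      (∀ a, 𝔼 ε, dropAt (fun ε => f (signSum (stepVec n q) S ε)) a ε ^ 2
        ≤ 4 * (8 * L ^ 2 / σ.card / q)) ∧
      3 / 4 * (σ.card * q) ≤ (S.card : ℝ) := by
  have hσR : (0 : ℝ) < σ.card := Nat.cast_pos.2 hσ
  have hq4 : (4 : ℝ) ≤ q := by exact_mod_cast hq
  have hqR : (0 : ℝ) < q := by linarith
  have hκ : 0 < 8 * L ^ 2 / σ.card / q := by positivity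
  obtain ⟨S, h1, h2, h3⟩ := exists_small_influence (stepVec n q) hf
    (σ ×ˢ (Finset.univ : Finset (Fin q))) hκ
  refine ⟨S, h1, h2, ?_⟩
  have hβ : 1 / √(q : ℝ) ≤ 1 / 2 :=
    one_div_le_one_div_of_le two_pos (le_sqrt_of_sq_le (by linarith))
  have h4 := expect_sq_le_of_cube
    (fun ε => f (signSum (stepVec n q) (σ ×ˢ (Finset.univ : Finset (Fin q))) ε))
    (dropAt_signSum_le _ hf (semi_stepVec_le hf hle) (by positivity) _) (by positivity) hβ
    (sum_dropAt_sq_le _ hf (semi_sum_stepVec_le hle) _)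
  have h5 : (𝔼 ε, f (signSum (stepVec n q) (σ ×ˢ (Finset.univ : Finset (Fin q))) ε)) ^ 2
      ≤ L ^ 2 := pow_le_pow_left₀ (expect_nonneg' fun ε => hf.nonneg _)
    ((expect_signSum_mono _ hf (Finset.subset_univ _)).trans hM) 2
  have h6 := h3.trans (h4.trans (by linarith : _ ≤ 2 * L ^ 2))
  rw [Finset.card_product, Finset.card_univ, Fintype.card_fin, Nat.cast_mul, div_div,
    div_mul_eq_mul_div, div_le_iff₀ (by positivity)] at h6
  have h7 : L ^ 2 * (8 * ((σ.card : ℝ) * q - S.card)) ≤ L ^ 2 * (2 * (σ.card * q)) := by linarith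
  have := le_of_mul_le_mul_left h7 (by positivity)
  linarith

lemma exists_trimmed_walk {n : ℕ} {f : (Fin n → ℝ) → ℝ} (hf : IsSemi f)
    (hle : ∀ x, f x ≤ euclNorm x) {L : ℝ} (hL0 : 0 < L) (hL : 4 * exp 6 ≤ L ^ 2)
    (hM : ∫ z, f z ∂stdGaussian n < L) {σ : Finset (Fin n)} (hσ : 0 < σ.card) :
    ∃ (q : ℕ → ℕ) (S : ∀ j, Finset (Fin n × Fin (q j))) (l : Fin n → ℝ),
      Filter.Tendsto q Filter.atTop Filter.atTop ∧
      (∀ i, Filter.Tendsto (fun j => (fibre (S j) i : ℝ) / q j) Filter.atTop (𝓝 (l i ^ 2))) ∧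
      (∀ j, S j ⊆ σ ×ˢ Finset.univ) ∧
      (∀ j a, 𝔼 ε, dropAt (fun ε => f (signSum (stepVec n (q j)) (S j) ε)) a ε ^ 2
        ≤ 4 * (8 * L ^ 2 / σ.card / q j)) ∧
      ∃ G ⊆ σ, σ.card ≤ 2 * G.card ∧ ∀ i ∈ G, 1 / 2 ≤ l i ^ 2 := by
  have h1 := (tendsto_expect_semi (q := id) Filter.tendsto_id (fun _ => Finset.univ) 1
    (tendsto_fibre_univ Filter.tendsto_id) hf hle).2
  simp only [one_mul, id] at h1
  obtain ⟨j₀, hj₀⟩ := Filter.eventually_atTop.1 (h1.eventually_lt_const hM)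
  have h2 : ∀ j, ∃ S ⊆ σ ×ˢ (Finset.univ : Finset (Fin (j + j₀ + 4))),
      (∀ a, 𝔼 ε, dropAt (fun ε => f (signSum (stepVec n (j + j₀ + 4)) S ε)) a ε ^ 2
        ≤ 4 * (8 * L ^ 2 / σ.card / (j + j₀ + 4 : ℕ))) ∧
      3 / 4 * (σ.card * (j + j₀ + 4 : ℕ)) ≤ (S.card : ℝ) := fun j =>
    exists_trimmed (by omega) hf hle hL0 hL (hj₀ _ (by omega)).le hσ
  choose S hS1 hS2 hS3 using h2
  let x : ℕ → Fin n → ℝ := fun j i => (fibre (S j) i : ℝ) / (j + j₀ + 4 : ℕ)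
  have hx : ∀ j, x j ∈ Set.Icc (0 : Fin n → ℝ) 1 := fun j =>
    ⟨fun i => by simp only [x, Pi.zero_apply]; positivity, fun i =>
      div_le_one_of_le₀ (Nat.cast_le.2 (fibre_le _ _)) (Nat.cast_nonneg _)⟩
  obtain ⟨a, ha, φ, hφ, hlim⟩ := isCompact_Icc.tendsto_subseq hx
  have hlim' : ∀ i, Filter.Tendsto (fun j => x (φ j) i) Filter.atTop (𝓝 (a i)) := fun i =>
    (tendsto_pi_nhds.1 hlim) i
  have hl : ∀ i, √(a i) ^ 2 = a i := fun i => sq_sqrt (ha.1 i)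
  refine ⟨fun j => φ j + j₀ + 4, fun j => S (φ j), fun i => √(a i), ?_, ?_, fun j => hS1 _,
    fun j => hS2 _, {i ∈ σ | 1 / 2 ≤ a i}, Finset.filter_subset _ _, ?_, ?_⟩
  · exact Filter.tendsto_atTop_mono (fun j => by omega) hφ.tendsto_atTop
  · intro i
    rw [hl]
    exact hlim' i
  · have h3 : ∀ j, 3 / 4 * (σ.card : ℝ) ≤ ∑ i ∈ σ, x j i := by
      intro j
      have hq : (0 : ℝ) < (j + j₀ + 4 : ℕ) := Nat.cast_pos.2 (by omega)
      simp only [x]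
      rw [← Finset.sum_div, le_div_iff₀ hq, ← Nat.cast_sum]
      have h4 : ∑ i ∈ σ, fibre (S j) i = (S j).card :=
        (Finset.card_eq_sum_card_fiberwise fun b hb =>
          (Finset.mem_product.1 (hS1 j hb)).1).symm
      rw [h4]
      linarith [hS3 j]
    have h5 : 3 / 4 * (σ.card : ℝ) ≤ ∑ i ∈ σ, a i :=
      ge_of_tendsto' (tendsto_finsetSum _ fun i _ => hlim' i) fun j => h3 _
    have h6 : ∑ i ∈ σ, a i ≤ ∑ i ∈ σ, (1 / 2 + 1 / 2 * if 1 / 2 ≤ a i then (1 : ℝ) else 0) :=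
      Finset.sum_le_sum fun i _ => by
        have := ha.2 i
        split_ifs with h
        · simp only [Pi.one_apply] at this; linarith
        · linarith
    rw [Finset.sum_add_distrib, ← Finset.mul_sum, Finset.sum_boole, Finset.sum_const,
      nsmul_eq_mul] at h6
    have h7 : (σ.card : ℝ) ≤ 2 * ({i ∈ σ | 1 / 2 ≤ a i} : Finset _).card := by linarith
    exact_mod_cast h7
  · intro i hi
    rw [hl]
    exact (Finset.mem_filter.1 hi).2

lemma tail_of_flat {n : ℕ} {f : (Fin n → ℝ) → ℝ} (hf : IsSemi f)
    (hle : ∀ x, f x ≤ euclNorm x) {L : ℝ} (hL1 : 1 ≤ L) (hL3 : 30 * L ^ 2 ≤ exp (L / 8))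
    {σ : Finset (Fin n)} (hσ : exp (L / 2) / 4 ≤ σ.card)
    (hK : ∀ c : Fin n → ℝ, (∀ i, |c i| ≤ 1) →
      f (∑ i ∈ σ, c i • (Pi.single i 1 : Fin n → ℝ)) ≤ 5 * L)
    {q : ℕ → ℕ} (hq : Filter.Tendsto q Filter.atTop Filter.atTop)
    (S : ∀ j, Finset (Fin n × Fin (q j))) (l : Fin n → ℝ)
    (hS : ∀ i, Filter.Tendsto (fun j => (fibre (S j) i : ℝ) / q j) Filter.atTop (𝓝 (l i ^ 2)))
    (hSσ : ∀ j, S j ⊆ σ ×ˢ Finset.univ)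
    (hκ : ∀ j a, 𝔼 ε, dropAt (fun ε => f (signSum (stepVec n (q j)) (S j) ε)) a ε ^ 2
      ≤ 4 * (8 * L ^ 2 / σ.card / q j)) (s : ℝ) :
    stdGaussian n {z | s < |f (l * z) - ∫ y, f (l * y) ∂stdGaussian n|}
      ≤ ENNReal.ofReal (2 * exp 2 * exp (-(√(L / 160) * s))) := by
  have hσ0 : (0 : ℝ) < σ.card := lt_of_lt_of_le (by positivity) hσ
  have hθ2 : √(L / 160) ^ 2 = L / 160 := sq_sqrt (by positivity)
  refine tail_of_expect_exp_le hq S l hS hf hle (sqrt_nonneg _) (fun τ hτ => ?_) s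
  have hτ2 : τ ^ 2 = L / 160 := by rw [← sq_abs, hτ, hθ2]
  filter_upwards [eventually_mul_inv_sqrt_le hq τ] with j hj
  have hcond : exp (L / 8) * √(8 * L ^ 2 / σ.card / q j) * (2 * (5 * L * √(q j))) ≤ 2 := by
    have h1 : √(8 * L ^ 2 / σ.card / q j) * √(q j) ≤ √(8 * L ^ 2 / σ.card) := by
      rw [sqrt_div' _ (Nat.cast_nonneg _)]
      rcases eq_or_ne (√(q j : ℝ)) 0 with h0 | h0
      · rw [h0, mul_zero]
        exact sqrt_nonneg _
      · rw [div_mul_cancel₀ _ h0]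
    have h2 : √(8 * L ^ 2 / σ.card) ≤ 6 * L / exp (L / 4) := by
      refine (sqrt_le_left (by positivity)).2 ?_
      have e : exp (L / 4) ^ 2 = exp (L / 2) := by rw [← exp_nat_mul]; congr 1; push_cast; ring
      rw [div_pow, e, div_le_div_iff₀ hσ0 (exp_pos _), mul_pow]
      nlinarith [mul_le_mul_of_nonneg_left hσ (sq_nonneg L), exp_pos (L / 2),
        mul_pos (pow_pos (lt_of_lt_of_le one_pos hL1) 2) (exp_pos (L / 2))]
    have e : exp (L / 4) = exp (L / 8) * exp (L / 8) := by rw [← exp_add]; congr 1; ring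
    calc _ = exp (L / 8) * (10 * L) * (√(8 * L ^ 2 / σ.card / q j) * √(q j)) := by ring
      _ ≤ exp (L / 8) * (10 * L) * (6 * L / exp (L / 4)) := by
        gcongr
        exact h1.trans h2
      _ = 2 * (30 * L ^ 2 / exp (L / 8)) := by
        rw [e]
        field_simp
        ring
      _ ≤ 2 * 1 := by
        gcongr
        exact div_le_one_of_le₀ hL3 (exp_pos _).le
      _ = 2 := mul_one _
  have h := mgf_cube_le_of_small_influence
    (fun ε => f (signSum (stepVec n (q j)) (S j) ε)) (θ := τ)
    (A := exp (L / 8)) (B := 2 * (5 * L * √(q j)))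
    (dropAt_signSum_le _ hf (semi_stepVec_le hf hle) (by positivity) (S j)) (by positivity)
    (sum_dropAt_sq_le _ hf (semi_sum_stepVec_le hle) (S j))
    (sum_dropAt_le _ hf (S j) (semi_sum_stepVec_le_of_bounded hf σ hK (hSσ j)))
    (hκ j) (by positivity) (one_lt_exp_iff.2 (by positivity)) hcond hj
    (by rw [log_exp, hτ2]; field_simp; norm_num)
  refine h.trans (exp_le_exp.2 ?_)
  rw [log_exp, hτ2]
  field_simp
  norm_num

lemma exists_weights {n : ℕ} {f : (Fin n → ℝ) → ℝ} (hf : IsSemi f)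
    (hle : ∀ x, f x ≤ euclNorm x) {L : ℝ} (hLn : exp L = n) (hL1 : 1 ≤ L)
    (hL2 : 4 * exp 6 ≤ L ^ 2) (hL3 : 30 * L ^ 2 ≤ exp (L / 8)) (hL4 : 32 * exp 1 ≤ exp (L / 4))
    (hM : ∫ z, f z ∂stdGaussian n < L) {s : Finset (Fin n)} (hs : n ≤ 2 * s.card)
    (hs2 : ∀ i ∈ s, 1 / 4 ≤ f (Pi.single i 1)) :
    ∃ l : Fin n → ℝ, √n / 8 ≤ (Finset.univ.filter fun i => l i ≠ 0).card ∧ ∀ t > 0,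
      stdGaussian n {z | t * (∫ y, f (l * y) ∂stdGaussian n)
          < |f (l * z) - ∫ y, f (l * y) ∂stdGaussian n|}
        ≤ ENNReal.ofReal (2 * exp 2 * exp (-(max (t ^ 2) t * L / 24576))) := by
  have hn : 1 ≤ n := by
    have : (0 : ℝ) < n := hLn ▸ exp_pos L
    exact Nat.cast_pos.1 this
  have hsq : √(n : ℝ) = exp (L / 2) := by
    rw [← hLn, show exp L = exp (L / 2) ^ 2 by rw [← exp_nat_mul]; congr 1; push_cast; ring,
      sqrt_sq (exp_pos _).le]
  have hL0 : 0 < L := by linarith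
  have hc := hf.continuous_of_le_euclNorm hle
  have hi := (tendsto_expect_semi (q := id) Filter.tendsto_id (fun _ => Finset.univ) 1
    (tendsto_fibre_univ Filter.tendsto_id) hf hle).1
  simp only [one_mul] at hi
  obtain ⟨σ, hσs, hσ, hK⟩ := exists_flat_subset hn hf hle hi hL1 hM.le hs
  rw [hsq] at hσ
  have hσ0 : 0 < σ.card := Nat.cast_pos.1 (lt_of_lt_of_le (by positivity) hσ)
  obtain ⟨q, S, l, hq, hS, hSσ, hκ, G, hGσ, hGc, hG⟩ := exists_trimmed_walk hf hle hL0 hL2 hM hσ0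
  have hGc' : exp (L / 2) / 8 ≤ (G.card : ℝ) := by
    have : (σ.card : ℝ) ≤ 2 * G.card := by exact_mod_cast hGc
    linarith
  have hil := (tendsto_expect_semi hq S l hS hf hle).1
  have hE : √L / 32 ≤ ∫ z, f (l * z) ∂stdGaussian n := by
    have h := le_integral_of_good_coords hf hc l hil G (a := 1 / 8) (R := √L / 2) (by norm_num)
      (fun i hiG => ?_) (by positivity) ?_
    · linarith
    · have h1 : 1 / 2 ≤ |l i| := by
        by_contra! hcon
        have := hG i hiG
        rw [← sq_abs] at this
        nlinarith [abs_nonneg (l i)]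
      calc (1 : ℝ) / 8 = 1 / 2 * (1 / 4) := by norm_num
        _ ≤ _ := mul_le_mul h1 (hs2 i (hσs (hGσ hiG))) (by norm_num) (abs_nonneg _)
    · have h1 : -(L / 4) - 1 ≤ -(√L / 2 + 1) ^ 2 / 2 := by
        nlinarith [sq_sqrt hL0.le, sq_nonneg (√L / 2 - 1)]
      have h2 : exp (L / 2) * exp (-(L / 4) - 1) = exp (L / 4) / exp 1 := by
        rw [← exp_add, ← exp_sub]; congr 1; ring
      calc (1 : ℝ) ≤ exp (L / 4) / exp 1 / 32 := by
            rw [le_div_iff₀ (by norm_num), le_div_iff₀ (exp_pos _)]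
            linarith
        _ = exp (L / 2) / 8 * (1 / 4 * exp (-(L / 4) - 1)) := by rw [← h2]; ring
        _ ≤ _ := by gcongr
  refine ⟨l, ?_, fun t ht => ?_⟩
  · rw [hsq]
    refine hGc'.trans (Nat.cast_le.2 (Finset.card_le_card fun i hiG => ?_))
    rw [Finset.mem_filter]
    refine ⟨Finset.mem_univ _, fun h => ?_⟩
    have := hG i hiG
    norm_num [h] at this
  · have hs : t * √L / 32 ≤ t * ∫ y, f (l * y) ∂stdGaussian n := by
      rw [mul_div_assoc]
      exact mul_le_mul_of_nonneg_left hE ht.le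
    have hLs : √L * √L = L := mul_self_sqrt hL0.le
    have hmono : {z | t * (∫ y, f (l * y) ∂stdGaussian n)
        < |f (l * z) - ∫ y, f (l * y) ∂stdGaussian n|}
        ⊆ {z | t * √L / 32 < |f (l * z) - ∫ y, f (l * y) ∂stdGaussian n|} :=
      fun z hz => lt_of_le_of_lt hs hz
    refine (measure_mono hmono).trans ?_
    rcases le_total (t ^ 2) t with h | h
    · rw [max_eq_right h]
      refine (tail_of_flat hf hle hL1 hL3 hσ hK hq S l hS hSσ hκ _).trans
        (ENNReal.ofReal_le_ofReal ?_)
      gcongr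
      have h1 : √L / 13 ≤ √(L / 160) := by
        refine le_sqrt_of_sq_le ?_
        rw [div_pow, sq, hLs]
        linarith
      have h2 : √L / 13 * (t * √L / 32) ≤ √(L / 160) * (t * √L / 32) := by gcongr
      have h3 : √L / 13 * (t * √L / 32) = t * L / 416 := by
        linear_combination (t / 416) * hLs
      have h4 : 0 < t * L := mul_pos ht hL0
      linarith
    · rw [max_eq_left h]
      refine (gaussian_concentration hq S l hS hf hle (by positivity)).trans
        (ENNReal.ofReal_le_ofReal ?_)
      have h1 : (t * √L / 32) ^ 2 / 24 = t ^ 2 * L / 24576 := by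
        linear_combination (t ^ 2 / 24576) * hLs
      rw [h1]
      gcongr
      linarith [one_le_exp (show (0 : ℝ) ≤ 2 by norm_num)]

lemma euclNorm_smul {n : ℕ} (r : ℝ) (x : Fin n → ℝ) : euclNorm (r • x) = |r| * euclNorm x := by
  have := norm_smul r (WithLp.toLp 2 x)
  rwa [← WithLp.toLp_smul, ← euclNorm_ofLp, ← euclNorm_ofLp, Real.norm_eq_abs] at this

lemma IsSemi.le_euclNorm {n : ℕ} {N : (Fin n → ℝ) → ℝ} (hN : IsSemi N)
    (h : ∀ x, euclNorm x ≤ 1 → N x ≤ 1) (x : Fin n → ℝ) : N x ≤ euclNorm x := by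
  have h0 : 0 ≤ euclNorm x := sqrt_nonneg _
  rcases h0.eq_or_lt with h0 | h0
  · have hx : x = 0 := by
      have : ‖WithLp.toLp 2 x‖ = 0 := by rw [← euclNorm_ofLp]; exact h0.symm
      simpa using this
    have h1 := hN.smul 0 x
    rw [zero_smul, abs_zero, zero_mul] at h1
    rw [← h0, hx, h1]
  · have h1 := h ((euclNorm x)⁻¹ • x) (by
      rw [euclNorm_smul, abs_of_pos (inv_pos.2 h0), inv_mul_cancel₀ h0.ne'])
    rwa [hN.smul, abs_of_pos (inv_pos.2 h0), inv_mul_le_iff₀ h0, mul_one] at h1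

/-- The linear isometry of `ℝⁿ` sending the standard basis to a given orthonormal basis. -/
noncomputable def basisMap {n : ℕ} (B : OrthonormalBasis (Fin n) ℝ (EuclideanSpace ℝ (Fin n))) :
    (Fin n → ℝ) →ₗ[ℝ] (Fin n → ℝ) :=
  (WithLp.linearEquiv 2 ℝ (Fin n → ℝ)).toLinearMap ∘ₗ B.repr.symm.toLinearEquiv.toLinearMap ∘ₗ
    (WithLp.linearEquiv 2 ℝ (Fin n → ℝ)).symm.toLinearMap

lemma basisMap_apply {n : ℕ} (B : OrthonormalBasis (Fin n) ℝ (EuclideanSpace ℝ (Fin n)))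
    (x : Fin n → ℝ) : basisMap B x = (B.repr.symm (WithLp.toLp 2 x)).ofLp := rfl

lemma euclNorm_basisMap {n : ℕ} (B : OrthonormalBasis (Fin n) ℝ (EuclideanSpace ℝ (Fin n)))
    (x : Fin n → ℝ) : euclNorm (basisMap B x) = euclNorm x := by
  rw [basisMap_apply, euclNorm_ofLp, LinearIsometryEquiv.norm_map, ← euclNorm_ofLp]

lemma basisMap_single {n : ℕ} (B : OrthonormalBasis (Fin n) ℝ (EuclideanSpace ℝ (Fin n)))
    (i : Fin n) : basisMap B (Pi.single i 1) = (B i).ofLp := by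
  rw [basisMap_apply]
  exact congrArg WithLp.ofLp (B.repr_symm_single i)

lemma euclNorm_extendByZero {m n : ℕ} {e : Fin m → Fin n} (he : e.Injective) (z : Fin m → ℝ) :
    euclNorm (Function.ExtendByZero.linearMap ℝ e z) = euclNorm z := by
  unfold euclNorm
  congr 1
  symm
  refine Fintype.sum_of_injective e he _ _ (fun i hi => ?_) fun k => ?_
  · rw [Function.ExtendByZero.linearMap_apply, Function.extend_apply' _ _ _ hi, Pi.zero_apply,
      sq, mul_zero]
  · rw [Function.ExtendByZero.linearMap_apply, he.extend_apply]

/-- If `f` has the stated deviation on the `l`-scaled Gaussian, the same holds on the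
coordinate subspace where `l` does not vanish. -/
lemma exists_coordinate_subspace {n : ℕ} {f : (Fin n → ℝ) → ℝ} (hf : Continuous f)
    (l : Fin n → ℝ) {m : ℕ} (hm : (Finset.univ.filter fun i => l i ≠ 0).card = m)
    (p : ℝ → ENNReal)
    (h : ∀ t > 0, stdGaussian n {z | t * (∫ y, f (l * y) ∂stdGaussian n)
          < |f (l * z) - ∫ y, f (l * y) ∂stdGaussian n|} ≤ p t) :
    ∃ (ι : (Fin m → ℝ) →ₗ[ℝ] (Fin n → ℝ)), (∀ z, euclNorm (ι z) = euclNorm z) ∧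
      ∃ T : (Fin m → ℝ) ≃ₗ[ℝ] (Fin m → ℝ), ∀ t > (0 : ℝ),
        stdGaussian m {z | t * (∫ y, f (ι (T y)) ∂stdGaussian m)
          < |f (ι (T z)) - ∫ y, f (ι (T y)) ∂stdGaussian m|} ≤ p t := by
  set e := (Finset.univ.filter fun i => l i ≠ 0).orderEmbOfFin hm with he
  have hl : ∀ k, l (e k) ≠ 0 := fun k =>
    (Finset.mem_filter.1 (Finset.orderEmbOfFin_mem _ hm k)).2
  have hr : ∀ i, l i ≠ 0 → i ∈ Set.range e := fun i hi => by
    rw [he, Finset.range_orderEmbOfFin]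
    simpa using hi
  refine ⟨Function.ExtendByZero.linearMap ℝ e, euclNorm_extendByZero e.injective,
    LinearEquiv.piCongrRight fun k => LinearEquiv.smulOfNeZero ℝ ℝ (l (e k)) (hl k), ?_⟩
  set T : (Fin m → ℝ) ≃ₗ[ℝ] (Fin m → ℝ) :=
    LinearEquiv.piCongrRight fun k => LinearEquiv.smulOfNeZero ℝ ℝ (l (e k)) (hl k)
  set ι : (Fin m → ℝ) →ₗ[ℝ] (Fin n → ℝ) := Function.ExtendByZero.linearMap ℝ e
  have hT : ∀ z : Fin n → ℝ, ι (T fun k => z (e k)) = l * z := fun z => by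
    funext i
    by_cases hi : l i = 0
    · have : ¬ ∃ k, e k = i := by
        rintro ⟨k, rfl⟩
        exact hl k hi
      simp only [ι, Function.ExtendByZero.linearMap_apply, Function.extend_apply' _ _ _ this,
        Pi.mul_apply, hi, zero_mul, Pi.zero_apply]
    · obtain ⟨k, rfl⟩ := hr i hi
      simp only [ι, Function.ExtendByZero.linearMap_apply, e.injective.extend_apply]
      rfl
  have hmp := measurePreserving_comp_injective e.injective
  have hc : Continuous fun z => f (ι (T z)) :=
    hf.comp ((ι.continuous_of_finiteDimensional).comp T.toLinearMap.continuous_of_finiteDimensional)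
  have hint : ∫ y, f (ι (T y)) ∂stdGaussian m = ∫ y, f (l * y) ∂stdGaussian n := by
    rw [← hmp.map_eq, integral_map hmp.measurable.aemeasurable hc.aestronglyMeasurable]
    simp only [hT]
  intro t ht
  rw [hint]
  have hmeas : MeasurableSet {z | t * (∫ y, f (l * y) ∂stdGaussian n)
      < |f (ι (T z)) - ∫ y, f (l * y) ∂stdGaussian n|} :=
    measurableSet_lt measurable_const (hc.sub continuous_const).abs.measurable
  rw [← hmp.measure_preimage hmeas.nullMeasurableSet]
  simp only [Set.preimage_ofPred_eq, hT]
  exact h t ht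

lemma tail_of_large_mean {n : ℕ} {f : (Fin n → ℝ) → ℝ} (hf : IsSemi f)
    (hle : ∀ x, f x ≤ euclNorm x) {L : ℝ} (hL1 : 1 ≤ L)
    (hM : L ≤ ∫ z, f z ∂stdGaussian n) {t : ℝ} (ht : 0 < t) :
    stdGaussian n {z | t * (∫ y, f y ∂stdGaussian n) < |f z - ∫ y, f y ∂stdGaussian n|}
      ≤ ENNReal.ofReal (2 * exp 2 * exp (-(max (t ^ 2) t * L / 24576))) := by
  have h := gaussian_concentration (q := id) Filter.tendsto_id (fun _ => Finset.univ) 1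
    (tendsto_fibre_univ Filter.tendsto_id) hf hle (s := t * L) (by positivity)
  simp only [one_mul] at h
  refine (measure_mono fun z hz => ?_).trans (h.trans (ENNReal.ofReal_le_ofReal ?_))
  · exact lt_of_le_of_lt (mul_le_mul_of_nonneg_left hM ht.le) hz
  · rw [mul_assoc, ← exp_add]
    gcongr
    rcases le_total (t ^ 2) t with h | h
    · rw [max_eq_right h]
      nlinarith [sq_nonneg (t * L - 1 / 2), mul_pos ht (by linarith : 0 < L)]
    · rw [max_eq_left h]
      nlinarith [mul_nonneg (sq_nonneg t) (by nlinarith : 0 ≤ L ^ 2 - L),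
        mul_nonneg (sq_nonneg t) (by linarith : 0 ≤ L)]

lemma eventually_log_conditions : ∃ n₀ : ℕ, ∀ n : ℕ, n₀ ≤ n →
    1 ≤ log n ∧ 4 * exp 6 ≤ log n ^ 2 ∧ 30 * log n ^ 2 ≤ exp (log n / 8) ∧
      32 * exp 1 ≤ exp (log n / 4) := by
  have hlog : Filter.Tendsto (fun n : ℕ => log (n : ℝ)) Filter.atTop Filter.atTop :=
    tendsto_log_atTop.comp tendsto_natCast_atTop_atTop
  have h3 : ∀ᶠ L : ℝ in Filter.atTop, 30 * L ^ 2 ≤ exp (L / 8) := by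
    have h := ((tendsto_exp_div_pow_atTop 2).comp
      (Filter.tendsto_id.atTop_div_const (show (0 : ℝ) < 8 by norm_num))).eventually_ge_atTop 1920
    filter_upwards [h, Filter.eventually_gt_atTop 0] with L hL hL0
    have := (le_div_iff₀ (by simp only [id]; positivity)).1 hL
    simp only [id] at this
    nlinarith
  have h4 : ∀ᶠ L : ℝ in Filter.atTop, 32 * exp 1 ≤ exp (L / 4) :=
    (tendsto_exp_atTop.comp (Filter.tendsto_id.atTop_div_const
      (show (0 : ℝ) < 4 by norm_num))).eventually_ge_atTop _
  have h2 : ∀ᶠ L : ℝ in Filter.atTop, 4 * exp 6 ≤ L ^ 2 :=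
    (Filter.tendsto_pow_atTop two_ne_zero).eventually_ge_atTop _
  exact Filter.eventually_atTop.1 (hlog.eventually
    ((Filter.eventually_ge_atTop 1).and (h2.and (h3.and h4))))

lemma exists_subspace_of_large {n : ℕ} {N : (Fin n → ℝ) → ℝ} (hN : IsSemi N)
    (hJ : JohnPosition N) (hn : 1 ≤ n) (hL1 : 1 ≤ log n)
    (hL2 : 4 * exp 6 ≤ log n ^ 2) (hL3 : 30 * log n ^ 2 ≤ exp (log n / 8))
    (hL4 : 32 * exp 1 ≤ exp (log n / 4)) :
    ∃ (m : ℕ) (ι : (Fin m → ℝ) →ₗ[ℝ] (Fin n → ℝ)), (∀ z, euclNorm (ι z) = euclNorm z) ∧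
      m ≤ n ∧ √n / 8 ≤ m ∧ ∃ T : (Fin m → ℝ) ≃ₗ[ℝ] (Fin m → ℝ), ∀ t > (0 : ℝ),
        stdGaussian m {z | t * (∫ y, N (ι (T y)) ∂stdGaussian m)
            < |N (ι (T z)) - ∫ y, N (ι (T y)) ∂stdGaussian m|}
          ≤ ENNReal.ofReal (2 * exp 2 * exp (-(max (t ^ 2) t * log n / 24576))) := by
  have hle := hN.le_euclNorm hJ.1
  obtain ⟨B, s, hs, hs2⟩ := dvoretzky_rogers hN hle hJ hn
  have hf : IsSemi fun x => N (basisMap B x) := hN.comp (basisMap B)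
  have hfle : ∀ x, N (basisMap B x) ≤ euclNorm x := fun x =>
    (hle _).trans (euclNorm_basisMap B x).le
  rcases le_or_gt (log n) (∫ z, N (basisMap B z) ∂stdGaussian n) with hM | hM
  · refine ⟨n, basisMap B, euclNorm_basisMap B, le_rfl, ?_, LinearEquiv.refl ℝ _,
      fun t ht => tail_of_large_mean hf hfle hL1 hM ht⟩
    have : √(n : ℝ) ≤ n :=
      sqrt_le_iff.2 ⟨Nat.cast_nonneg _, le_self_pow₀ (by exact_mod_cast hn) two_ne_zero⟩
    have := sqrt_nonneg (n : ℝ)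
    linarith
  · obtain ⟨l, hl, ht⟩ := exists_weights hf hfle
      (exp_log (by exact_mod_cast hn)) hL1 hL2 hL3 hL4 hM hs
      (fun i hi => by simpa only [basisMap_single] using hs2 i hi)
    obtain ⟨ι, hι, T, hT⟩ := exists_coordinate_subspace (hf.continuous_of_le_euclNorm hfle) l rfl
      _ ht
    refine ⟨_, basisMap B ∘ₗ ι, fun z => ?_, ?_, hl, T, hT⟩
    · rw [LinearMap.comp_apply, euclNorm_basisMap, hι]
    · exact (Finset.card_le_univ _).trans (Fintype.card_fin n).le

/-- Dichotomy: for `X = (ℝⁿ, N)` in John's position and `0 < δ < 1/2`, either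
`k(X) ≥ n^{1/2−δ}`, or there is a subspace `F` (the range of a Euclidean isometric
embedding `ι : ℝᵐ → ℝⁿ`) of dimension `m ≥ c√n` and an invertible `T : F → F` with
`P(| ‖TZ‖ − E‖TZ‖ | > t E‖TZ‖) ≤ C exp(−cδ max{t²,t} log m)` for `Z ~ N(0, I_F)`. -/
theorem statement12 :
    ∃ C > (0 : ℝ), ∃ c > (0 : ℝ), ∀ n : ℕ, 1 ≤ n →
      ∀ N : (Fin n → ℝ) → ℝ,
        (∀ x y, N (x + y) ≤ N x + N y) →
        (∀ (r : ℝ) (x), N (r • x) = |r| * N x) →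
        (∀ x, N x = 0 → x = 0) →
        JohnPosition N →
        ∀ δ : ℝ, 0 < δ → δ < 1 / 2 →
          (n : ℝ) ^ ((1 : ℝ) / 2 - δ) ≤ critDim n N ∨
          ∃ (m : ℕ) (ι : (Fin m → ℝ) →ₗ[ℝ] (Fin n → ℝ)),
            (∀ z, euclNorm (ι z) = euclNorm z) ∧
            c * Real.sqrt n ≤ (m : ℝ) ∧
            ∃ T : (Fin m → ℝ) ≃ₗ[ℝ] (Fin m → ℝ), ∀ t > (0 : ℝ),
              stdGaussian m
                  {z | t * (∫ y, N (ι (T y)) ∂stdGaussian m) <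
                        |N (ι (T z)) - ∫ y, N (ι (T y)) ∂stdGaussian m|}
                ≤ ENNReal.ofReal
                    (C * Real.exp (-c * δ * max (t ^ 2) t * Real.log m)) := by
  obtain ⟨n₀, hn₀⟩ := eventually_log_conditions
  refine ⟨2 * exp 2, by positivity, min (1 / 24576) (1 / √(n₀ + 1)), by positivity, ?_⟩
  set c : ℝ := min (1 / 24576) (1 / √(n₀ + 1))
  have hc0 : 0 < c := by positivity
  have hc1 : c ≤ 1 / 24576 := min_le_left _ _
  intro n hn N hadd hsmul _ hJ δ hδ hδ'
  right
  rcases le_or_gt n₀ n with hnn | hnn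
  · obtain ⟨h1, h2, h3, h4⟩ := hn₀ n hnn
    obtain ⟨m, ι, hι, hmn, hm, T, hT⟩ :=
      exists_subspace_of_large ⟨hadd, hsmul⟩ hJ hn h1 h2 h3 h4
    refine ⟨m, ι, hι, ?_, T, fun t ht => (hT t ht).trans (ENNReal.ofReal_le_ofReal ?_)⟩
    · have := sqrt_nonneg (n : ℝ)
      nlinarith
    · gcongr
      have hn1 : (1 : ℝ) ≤ n := by exact_mod_cast hn
      have hm0 : (0 : ℝ) < m := lt_of_lt_of_le (by positivity) hm
      have hlog : log m ≤ log n := log_le_log hm0 (by exact_mod_cast hmn)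
      have hlm : 0 ≤ log m := log_nonneg (by
        have : 0 < m := by exact_mod_cast hm0
        exact_mod_cast this)
      have hcδ : c * δ ≤ 1 / 24576 := by nlinarith
      have hM : 0 ≤ max (t ^ 2) t := ht.le.trans (le_max_right _ _)
      have : c * δ * (max (t ^ 2) t * log m) ≤ 1 / 24576 * (max (t ^ 2) t * log n) := by gcongr
      linarith
  · refine ⟨1, LinearMap.toSpanSingleton ℝ (Fin n → ℝ) (Pi.single ⟨0, hn⟩ 1) ∘ₗ LinearMap.proj 0,
      fun z => ?_, ?_, LinearEquiv.refl ℝ _, fun t ht => ?_⟩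
    · rw [LinearMap.comp_apply, LinearMap.toSpanSingleton_apply, euclNorm_smul, euclNorm_single,
        mul_one]
      simp [euclNorm, sqrt_sq_eq_abs]
    · have h1 : √(n : ℝ) ≤ √(n₀ + 1) := sqrt_le_sqrt (by
        have : (n : ℝ) < n₀ := by exact_mod_cast hnn
        linarith)
      rw [Nat.cast_one]
      calc c * √n ≤ 1 / √(n₀ + 1) * √(n₀ + 1) := by
            gcongr
            exact min_le_right _ _
        _ = 1 := one_div_mul_cancel (by positivity)
    · refine prob_le_one.trans ?_
      rw [Nat.cast_one, log_one, mul_zero, exp_zero, mul_one, ENNReal.one_le_ofReal]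
      linarith [one_le_exp (show (0 : ℝ) ≤ 2 by norm_num)]
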